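/- arXiv:1706.01227 — 11 statements merged into one kernel-verified Lean document; each statement's English description precedes it below -/
import Mathlib

section
/- Let a ∈ ℚ₂ with ‖a‖ > 1 and suppose there is no b ∈ ℚ₂ with b² = 1 - a. Then for every z ∈ OnePoint ℚ₂, the sequence of iterates ψ^[n](z) tends to ∞ (i.e. Tendsto (fun n => ψ^[n] z) atTop (𝓝 ∞)). -/
open Filter Topology Metric OnePoint

open scoped Classical in
/-- The rational map `x ↦ a·x + 1/x` on the projective line `P¹(ℚ₂) = OnePoint ℚ₂`:
`ψ(∞) = ∞`, `ψ(0) = ∞`, and `ψ(x) = a·x + x⁻¹` for nonzero `x ∈ ℚ₂`. -/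
noncomputable def psi (a : ℚ_[2]) : OnePoint ℚ_[2] → OnePoint ℚ_[2] :=
  fun z => OnePoint.rec ∞
    (fun x => if x = 0 then ∞ else ((a * x + x⁻¹ : ℚ_[2]) : OnePoint ℚ_[2])) z

/-- In the ring of `2`-adic integers, every element congruent to `1` modulo `8` is a square. -/
theorem PadicInt.exists_sq_eq_one_add_eight_mul (s : ℤ_[2]) : ∃ b : ℤ_[2], b ^ 2 = 1 + 8 * s := by
  have h2 : ‖(2 : ℤ_[2])‖ < 1 := (PadicInt.norm_lt_one_iff_dvd 2).2 (by norm_num)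
  obtain ⟨y, hy, -⟩ := hensels_lemma (p := 2)
    (F := (Polynomial.X ^ 2 + Polynomial.X - Polynomial.C (2 * s) : Polynomial ℤ_[2])) (a := 0) (by
      simp only [map_sub, map_add, map_pow, Polynomial.aeval_X, Polynomial.aeval_C,
        Polynomial.derivative_X_pow, Polynomial.derivative_X, Polynomial.derivative_C]
      simp
      nlinarith [PadicInt.norm_le_one s, norm_nonneg s, norm_nonneg (2 : ℤ_[2])])
  refine ⟨1 + 2 * y, ?_⟩
  simp only [map_sub, map_add, map_pow, Polynomial.aeval_X, Polynomial.aeval_C,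
    Algebra.algebraMap_self, RingHom.id_apply] at hy
  linear_combination 4 * hy

/-- Any `2`-adic unit is congruent to `1` modulo `2`. -/
theorem PadicInt.two_dvd_one_sub_of_norm_eq_one {u : ℤ_[2]} (hu : ‖u‖ = 1) : 2 ∣ 1 - u := by
  have key : ∀ v : ℤ_[2], PadicInt.toZMod v = 0 ↔ (2 : ℤ_[2]) ∣ v := fun v => by
    rw [← RingHom.mem_ker, PadicInt.ker_toZMod, PadicInt.maximalIdeal_eq_span_p,
      Ideal.mem_span_singleton]
    norm_num
  have hne : PadicInt.toZMod u ≠ 0 := fun h => by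
    have := (PadicInt.norm_lt_one_iff_dvd (p := 2) u).2 (by simpa using (key u).1 h)
    linarith
  rw [← key, map_sub, map_one]
  generalize PadicInt.toZMod u = w at hne
  revert w
  decide

/-- If `x` and its image under `x ↦ a * x + x⁻¹` both lie on the sphere `‖a‖ * ‖x‖ ^ 2 = 1`,
then `1 - a` is a square. -/
theorem Padic.exists_sq_eq_one_sub {a x : ℚ_[2]} (ha : 1 < ‖a‖) (hx : ‖a‖ * ‖x‖ ^ 2 = 1)
    (hx' : ‖a‖ * ‖a * x + x⁻¹‖ ^ 2 = 1) : ∃ b : ℚ_[2], b ^ 2 = 1 - a := by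
  have hx0 : x ≠ 0 := by rintro rfl; simp at hx
  have hnorm : ‖a * x + x⁻¹‖ = ‖x‖ := by
    have : ‖a * x + x⁻¹‖ ^ 2 = ‖x‖ ^ 2 :=
      mul_left_cancel₀ (by positivity : ‖a‖ ≠ 0) (hx'.trans hx.symm)
    exact (pow_left_inj₀ (norm_nonneg _) (norm_nonneg _) two_ne_zero).1 this
  have hx1 : ‖x‖ < 1 := by
    by_contra! h
    nlinarith [mul_self_nonneg (‖x‖ - 1)]
  have hu : ‖(a * x + x⁻¹) / x‖ = 1 := by
    rw [norm_div, hnorm, div_self (norm_ne_zero_iff.2 hx0)]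
  obtain ⟨w, hw⟩ := (PadicInt.norm_lt_one_iff_dvd (p := 2) ⟨x, hx1.le⟩).1 hx1
  obtain ⟨v, hv⟩ := PadicInt.two_dvd_one_sub_of_norm_eq_one (u := ⟨_, hu.le⟩) hu
  obtain ⟨b, hb⟩ := PadicInt.exists_sq_eq_one_add_eight_mul (w ^ 2 * v)
  have hw' : x = 2 * (w : ℚ_[2]) := congrArg Subtype.val hw
  have hv' : 1 - (a * x + x⁻¹) / x = 2 * (v : ℚ_[2]) := congrArg Subtype.val hv
  have hb' : (b : ℚ_[2]) ^ 2 = 1 + 8 * ((w : ℚ_[2]) ^ 2 * v) := by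
    exact_mod_cast congrArg Subtype.val hb
  refine ⟨b / x, ?_⟩
  have h8 : 8 * ((w : ℚ_[2]) ^ 2 * v) = x ^ 2 * (1 - (a * x + x⁻¹) / x) := by
    rw [hv']
    nth_rewrite 1 [hw']
    ring
  rw [div_pow, hb', h8]
  field_simp
  ring

theorem psi_infty (a : ℚ_[2]) : psi a ∞ = ∞ := rfl

theorem psi_zero (a : ℚ_[2]) : psi a ((0 : ℚ_[2]) : OnePoint ℚ_[2]) = ∞ := if_pos rfl

theorem psi_coe {a x : ℚ_[2]} (hx : x ≠ 0) :
    psi a (x : OnePoint ℚ_[2]) = ((a * x + x⁻¹ : ℚ_[2]) : OnePoint ℚ_[2]) := if_neg hx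

/-- The orbit under `psi a` of a point outside the sphere `‖a‖ * ‖x‖ ^ 2 = 1` grows
geometrically. -/
theorem exists_psi_iterate_eq_coe {a x : ℚ_[2]} (ha : 1 < ‖a‖) (hx : 1 < ‖a‖ * ‖x‖ ^ 2) (n : ℕ) :
    ∃ y : ℚ_[2], (psi a)^[n] x = y ∧ ‖y‖ = ‖a‖ ^ n * ‖x‖ := by
  induction n with
  | zero => exact ⟨x, rfl, by simp⟩
  | succ n ih =>
    obtain ⟨y, hy, hyn⟩ := ih
    have hy1 : 1 < ‖a‖ * ‖y‖ ^ 2 := by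
      rw [hyn]
      have h1 : 1 ≤ (‖a‖ ^ n) ^ 2 := one_le_pow₀ (one_le_pow₀ ha.le)
      calc 1 < ‖a‖ * ‖x‖ ^ 2 := hx
        _ ≤ (‖a‖ ^ n) ^ 2 * (‖a‖ * ‖x‖ ^ 2) := le_mul_of_one_le_left (by positivity) h1
        _ = _ := by ring
    have hy0 : y ≠ 0 := by rintro rfl; simp at hy1; linarith
    have hlt : ‖y⁻¹‖ < ‖a * y‖ := by
      rw [norm_inv, norm_mul, inv_lt_iff_one_lt_mul₀ (norm_pos_iff.2 hy0)]
      linarith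
    refine ⟨a * y + y⁻¹, ?_, ?_⟩
    · rw [Function.iterate_succ_apply', hy, psi_coe hy0]
    · rw [Padic.add_eq_max_of_ne hlt.ne', max_eq_left hlt.le, norm_mul, hyn]
      ring

theorem tendsto_psi_iterate_of_one_lt {a x : ℚ_[2]} (ha : 1 < ‖a‖) (hx : 1 < ‖a‖ * ‖x‖ ^ 2) :
    Tendsto (fun n => (psi a)^[n] x) atTop (𝓝 (∞ : OnePoint ℚ_[2])) := by
  choose y hy hyn using exists_psi_iterate_eq_coe ha hx
  have hx0 : 0 < ‖x‖ := by
    rw [norm_pos_iff]; rintro rfl; simp at hx; linarith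
  have hc : Tendsto y atTop (coclosedCompact ℚ_[2]) := by
    rw [coclosedCompact_eq_cocompact, ← Metric.cobounded_eq_cocompact,
      ← tendsto_norm_atTop_iff_cobounded]
    simp only [hyn]
    exact (tendsto_pow_atTop_atTop_of_one_lt ha).atTop_mul_const hx0
  simp only [hy]
  exact OnePoint.tendsto_coe_infty.comp hc

theorem tendsto_psi_iterate_of_psi {a : ℚ_[2]} {z : OnePoint ℚ_[2]}
    (h : Tendsto (fun n => (psi a)^[n] (psi a z)) atTop (𝓝 ∞)) :
    Tendsto (fun n => (psi a)^[n] z) atTop (𝓝 (∞ : OnePoint ℚ_[2])) :=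
  (tendsto_add_atTop_iff_nat 1).1 h

theorem tendsto_psi_iterate_infty (a : ℚ_[2]) :
    Tendsto (fun n => (psi a)^[n] ∞) atTop (𝓝 (∞ : OnePoint ℚ_[2])) := by
  simp only [Function.iterate_fixed (psi_infty a), tendsto_const_nhds]

theorem tendsto_psi_iterate_of_ne_one {a x : ℚ_[2]} (ha : 1 < ‖a‖) (hx : ‖a‖ * ‖x‖ ^ 2 ≠ 1) :
    Tendsto (fun n => (psi a)^[n] x) atTop (𝓝 (∞ : OnePoint ℚ_[2])) := by
  rcases hx.lt_or_gt with hlt | hgt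
  · apply tendsto_psi_iterate_of_psi
    rcases eq_or_ne x 0 with rfl | hx0
    · rw [psi_zero]
      exact tendsto_psi_iterate_infty a
    have hxpos : 0 < ‖x‖ := norm_pos_iff.2 hx0
    have hlt' : ‖a * x‖ < ‖x⁻¹‖ := by
      rw [norm_inv, norm_mul, ← one_div, lt_div_iff₀ hxpos]
      linarith
    rw [psi_coe hx0]
    apply tendsto_psi_iterate_of_one_lt ha
    rw [Padic.add_eq_max_of_ne hlt'.ne, max_eq_right hlt'.le, norm_inv, inv_pow,
      ← div_eq_mul_inv, one_lt_div (by positivity)]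
    nlinarith [sq_nonneg ‖x‖]
  · exact tendsto_psi_iterate_of_one_lt ha hgt

theorem stmt_0 (a : ℚ_[2]) (ha : 1 < ‖a‖) (hsq : ¬ ∃ b : ℚ_[2], b ^ 2 = 1 - a)
    (z : OnePoint ℚ_[2]) :
    Tendsto (fun n => (psi a)^[n] z) atTop (𝓝 (∞ : OnePoint ℚ_[2])) := by
  induction z using OnePoint.rec with
  | infty => exact tendsto_psi_iterate_infty a
  | coe x =>
    by_cases hx : ‖a‖ * ‖x‖ ^ 2 = 1
    · have hx0 : x ≠ 0 := by rintro rfl; simp at hx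
      apply tendsto_psi_iterate_of_psi
      rw [psi_coe hx0]
      exact tendsto_psi_iterate_of_ne_one ha fun h => hsq (Padic.exists_sq_eq_one_sub ha hx h)
    · exact tendsto_psi_iterate_of_ne_one ha hx
end

section
/- Let a ∈ ℚ₂ with ‖a‖ > 1 and let x ∈ ℚ₂ with ‖x‖ ≥ 1. Then for every n ∈ ℕ, ‖φ^[n](x)‖ = ‖a‖ⁿ · ‖x‖; in particular ‖φ^[n](x)‖ → ∞ as n → ∞. -/
open Filter Topology

/-- The rational map `φ(x) = a·x + 1/x` on `ℚ₂` (with the convention `0⁻¹ = 0`). -/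
noncomputable def phi (a : ℚ_[2]) (x : ℚ_[2]) : ℚ_[2] := a * x + x⁻¹

theorem norm_phi {a x : ℚ_[2]} (ha : 1 < ‖a‖) (hx : 1 ≤ ‖x‖) : ‖phi a x‖ = ‖a‖ * ‖x‖ := by
  have hlt : ‖x⁻¹‖ < ‖a * x‖ := by
    rw [norm_inv, norm_mul]
    exact (inv_le_one_of_one_le₀ hx).trans_lt (one_lt_mul_of_lt_of_le ha hx)
  rw [phi, Padic.add_eq_max_of_ne hlt.ne', max_eq_left hlt.le, norm_mul]

theorem norm_iterate_phi {a x : ℚ_[2]} (ha : 1 < ‖a‖) (hx : 1 ≤ ‖x‖) (n : ℕ) :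
    ‖(phi a)^[n] x‖ = ‖a‖ ^ n * ‖x‖ := by
  induction n with
  | zero => simp
  | succ n ih =>
    have h : 1 ≤ ‖(phi a)^[n] x‖ := ih ▸ one_le_mul_of_one_le_of_one_le (one_le_pow₀ ha.le) hx
    rw [Function.iterate_succ_apply', norm_phi ha h, ih, pow_succ']
    ring

theorem stmt_1 (a : ℚ_[2]) (ha : 1 < ‖a‖) (x : ℚ_[2]) (hx : 1 ≤ ‖x‖) :
    (∀ n : ℕ, ‖(phi a)^[n] x‖ = ‖a‖ ^ n * ‖x‖) ∧
    Tendsto (fun n : ℕ => ‖(phi a)^[n] x‖) atTop atTop := by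
  refine ⟨norm_iterate_phi ha hx, ?_⟩
  simp only [norm_iterate_phi ha hx]
  exact (tendsto_pow_atTop_atTop_of_one_lt ha).atTop_mul_const (one_pos.trans_le hx)
end

section
/- Let a ∈ ℚ₂ with ‖a‖ > 1 and let b ∈ ℚ₂ satisfy b² = 1 - a (note b ≠ 0). Then 1/b and -1/b are fixed points of φ, i.e. φ(1/b) = 1/b and φ(-1/b) = -1/b; moreover the common multiplier 2a - 1 of these fixed points satisfies ‖2a - 1‖ = ‖2a‖ > 1, so both fixed points are repelling. -/
/-- A 2-adic number of norm greater than `1` has norm at least `2`. -/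
theorem Padic.two_le_norm_of_one_lt {x : ℚ_[2]} (hx : 1 < ‖x‖) : 2 ≤ ‖x‖ := by
  have hx0 : x ≠ 0 := by
    rintro rfl
    simp at hx
    linarith
  rw [Padic.norm_eq_zpow_neg_valuation hx0] at hx ⊢
  push_cast at hx ⊢
  have h : 0 < -x.valuation := (one_lt_zpow_iff_right₀ (by norm_num : (1 : ℝ) < 2)).1 hx
  calc (2 : ℝ) = 2 ^ (1 : ℤ) := by norm_num
    _ ≤ 2 ^ (-x.valuation) := zpow_le_zpow_right₀ (by norm_num) h

/-- Subtracting `1` does not change a `p`-adic norm greater than `1`. -/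
theorem Padic.norm_sub_one_of_one_lt {p : ℕ} [Fact p.Prime] {x : ℚ_[p]} (hx : 1 < ‖x‖) :
    ‖x - 1‖ = ‖x‖ := by
  have h : ‖x‖ ≠ ‖(-1 : ℚ_[p])‖ := by
    rw [norm_neg, norm_one]
    exact hx.ne'
  rw [sub_eq_add_neg, Padic.add_eq_max_of_ne h, norm_neg, norm_one, max_eq_left hx.le]

theorem stmt_2 (a b : ℚ_[2]) (ha : 1 < ‖a‖) (hb : b ^ 2 = 1 - a) :
    b ≠ 0 ∧
    phi a (1 / b) = 1 / b ∧ phi a (-(1 / b)) = -(1 / b) ∧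
    ‖2 * a - 1‖ = ‖2 * a‖ ∧ 1 < ‖2 * a - 1‖ := by
  have hnorm : ‖b‖ ^ 2 = ‖a‖ := by
    rw [← norm_pow, hb, norm_sub_rev, Padic.norm_sub_one_of_one_lt ha]
  have hb1 : 1 < ‖b‖ := by
    rw [← hnorm] at ha
    nlinarith [norm_nonneg b]
  have hb0 : b ≠ 0 := by
    rintro rfl
    simp at hb1
    linarith
  have hfix : phi a (1 / b) = 1 / b := by
    unfold phi
    field_simp
    rw [hb]
    ring
  have h2a : 1 < ‖2 * a‖ := by
    have h2 : ‖(2 : ℚ_[2])‖ = 2⁻¹ := by simpa using Padic.norm_p (p := 2)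
    rw [norm_mul, h2, ← hnorm]
    nlinarith [Padic.two_le_norm_of_one_lt hb1]
  have hodd : phi a (-(1 / b)) = -phi a (1 / b) := by
    simp only [phi, inv_neg]
    ring
  have hmul := Padic.norm_sub_one_of_one_lt h2a
  exact ⟨hb0, hfix, by rw [hodd, hfix], hmul, by rwa [hmul]⟩
end

section
/- Let a ∈ ℚ₂ with ‖a‖ > 1 and let b ∈ ℚ₂ satisfy b² = 1 - a. Then for all x, y lying in closedBall(1/b, 1/(4·√‖a‖)) (or both lying in closedBall(-1/b, 1/(4·√‖a‖))), one has ‖φ(x) - φ(y)‖ = (‖a‖/2)·‖x - y‖; moreover φ '' closedBall(1/b, 1/(4·√‖a‖)) = φ '' closedBall(-1/b, 1/(4·√‖a‖)) = closedBall(1/b, √‖a‖/8). -/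
open Metric Set

theorem phi_neg (a x : ℚ_[2]) : phi a (-x) = -phi a x := by
  simp only [phi, inv_neg]
  ring

/-- For `‖a‖ > 1`, a square root `b` of `1 - a` has norm `√‖a‖`. -/
theorem norm_sq_eq_of_sq_eq_one_sub {a b : ℚ_[2]} (ha : 1 < ‖a‖) (hb : b ^ 2 = 1 - a) :
    ‖b‖ ^ 2 = ‖a‖ := by
  rw [← norm_pow, hb, sub_eq_add_neg, Padic.add_eq_max_of_ne, norm_neg, norm_one,
    max_eq_right ha.le]
  rw [norm_neg, norm_one]
  exact ha.ne

theorem two_le_norm_of_one_lt {b : ℚ_[2]} (h : 1 < ‖b‖) : 2 ≤ ‖b‖ := by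
  have h0 : b ≠ 0 := by
    rintro rfl
    norm_num at h
  have hn := Padic.norm_eq_zpow_neg_valuation h0
  have hn' : ‖b‖ = (2 : ℝ) ^ (-b.valuation) := by
    rw [hn]
    push_cast
    rfl
  rw [hn'] at h ⊢
  have h1 : 0 < -b.valuation := (one_lt_zpow_iff_right₀ one_lt_two).1 h
  calc (2 : ℝ) = 2 ^ (1 : ℤ) := (zpow_one _).symm
    _ ≤ 2 ^ (-b.valuation) := zpow_le_zpow_right₀ one_le_two h1

theorem norm_two_padic_two : ‖(2 : ℚ_[2])‖ = 1 / 2 := by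
  have := Padic.norm_p (p := 2)
  push_cast at this
  rw [this, one_div]

theorem norm_two_mul_sub_one {a : ℚ_[2]} (ha : 4 ≤ ‖a‖) : ‖2 * a - 1‖ = ‖a‖ / 2 := by
  have h2a : ‖2 * a‖ = ‖a‖ / 2 := by
    rw [norm_mul, norm_two_padic_two]
    ring
  rw [sub_eq_add_neg, Padic.add_eq_max_of_ne, norm_neg, norm_one, h2a, max_eq_left]
  · linarith
  · rw [norm_neg, norm_one, h2a]
    linarith

/-- Near `b⁻¹`, the inverse of a product of two points is close to `b ^ 2`. -/
theorem norm_inv_mul_inv_sub_sq_le {b x y : ℚ_[2]} (hb : b ≠ 0)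
    (hx : ‖x - 1 / b‖ ≤ 1 / (4 * ‖b‖)) (hy : ‖y - 1 / b‖ ≤ 1 / (4 * ‖b‖)) :
    x ≠ 0 ∧ y ≠ 0 ∧ ‖x⁻¹ * y⁻¹ - b ^ 2‖ ≤ ‖b‖ ^ 2 / 4 := by
  have hb0 : 0 < ‖b‖ := norm_pos_iff.2 hb
  have key : ∀ z : ℚ_[2], ‖z - 1 / b‖ ≤ 1 / (4 * ‖b‖) → ‖b * z - 1‖ ≤ 1 / 4 ∧ ‖b * z‖ = 1 := by
    intro z hz
    have h1 : ‖b * z - 1‖ ≤ 1 / 4 := by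
      have : b * z - 1 = b * (z - 1 / b) := by field_simp
      rw [this, norm_mul]
      calc ‖b‖ * ‖z - 1 / b‖ ≤ ‖b‖ * (1 / (4 * ‖b‖)) := by gcongr
        _ = 1 / 4 := by field_simp
    refine ⟨h1, ?_⟩
    have h2 : b * z = (b * z - 1) + 1 := by ring
    rw [h2, Padic.add_eq_max_of_ne, norm_one, max_eq_right]
    · linarith
    · rw [norm_one]
      intro h
      linarith
  obtain ⟨hx1, hx2⟩ := key x hx
  obtain ⟨hy1, hy2⟩ := key y hy
  have hx0 : x ≠ 0 := by
    rintro rfl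
    norm_num at hx2
  have hy0 : y ≠ 0 := by
    rintro rfl
    norm_num at hy2
  refine ⟨hx0, hy0, ?_⟩
  have hd : x⁻¹ * y⁻¹ - b ^ 2 =
      -(b ^ 2 * ((b * x)⁻¹ * (b * y)⁻¹ * ((b * x - 1) * (b * y) + (b * y - 1)))) := by
    field_simp
    ring
  rw [hd, norm_neg, norm_mul, norm_mul, norm_mul, norm_inv, norm_inv, hx2, hy2, norm_pow]
  have hm : ‖(b * x - 1) * (b * y) + (b * y - 1)‖ ≤ 1 / 4 := by
    refine (Padic.nonarchimedean _ _).trans (max_le ?_ hy1)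
    rw [norm_mul, hy2, mul_one]
    exact hx1
  rw [inv_one, one_mul, one_mul]
  nlinarith [sq_nonneg ‖b‖]

/-- On the ball around the fixed point `1 / b`, the map `φ` is close to the linear map
`x ↦ (2 * a - 1) * x`. -/
theorem norm_phi_sub_linear_le {a b x y : ℚ_[2]} (hb0 : b ≠ 0) (hb : b ^ 2 = 1 - a)
    (hx : ‖x - 1 / b‖ ≤ 1 / (4 * ‖b‖)) (hy : ‖y - 1 / b‖ ≤ 1 / (4 * ‖b‖)) :
    ‖phi a x - phi a y - (2 * a - 1) * (x - y)‖ ≤ ‖b‖ ^ 2 / 4 * ‖x - y‖ := by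
  obtain ⟨hx0, hy0, hd⟩ := norm_inv_mul_inv_sub_sq_le hb0 hx hy
  have h : phi a x - phi a y - (2 * a - 1) * (x - y) =
      -((x⁻¹ * y⁻¹ - b ^ 2) * (x - y)) := by
    rw [hb]
    simp only [phi]
    field_simp
    ring
  rw [h, norm_neg, norm_mul]
  gcongr

theorem norm_phi_sub_phi {a b x y : ℚ_[2]} (ha : 1 < ‖a‖) (hb : b ^ 2 = 1 - a)
    (h4 : 4 ≤ ‖a‖) (hb0 : b ≠ 0)
    (hx : ‖x - 1 / b‖ ≤ 1 / (4 * ‖b‖)) (hy : ‖y - 1 / b‖ ≤ 1 / (4 * ‖b‖)) :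
    ‖phi a x - phi a y‖ = ‖a‖ / 2 * ‖x - y‖ := by
  have h := norm_phi_sub_linear_le hb0 hb hx hy
  rw [norm_sq_eq_of_sq_eq_one_sub ha hb] at h
  rcases eq_or_ne x y with rfl | hxy
  · simp
  have hpos : 0 < ‖x - y‖ := norm_pos_iff.2 (sub_ne_zero.2 hxy)
  have hlin : ‖(2 * a - 1) * (x - y)‖ = ‖a‖ / 2 * ‖x - y‖ := by
    rw [norm_mul, norm_two_mul_sub_one h4]
  have hlt : ‖phi a x - phi a y - (2 * a - 1) * (x - y)‖ < ‖(2 * a - 1) * (x - y)‖ := by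
    rw [hlin]
    nlinarith
  have hs : phi a x - phi a y =
      (phi a x - phi a y - (2 * a - 1) * (x - y)) + (2 * a - 1) * (x - y) := by ring
  rw [hs, Padic.add_eq_max_of_ne hlt.ne, max_eq_right hlt.le, hlin]

theorem phi_one_div {a b : ℚ_[2]} (hb0 : b ≠ 0) (hb : b ^ 2 = 1 - a) :
    phi a (1 / b) = 1 / b := by
  have : a = 1 - b ^ 2 := by rw [hb]; ring
  simp only [phi, this]
  field_simp
  ring

theorem image_phi_closedBall {a b : ℚ_[2]} (ha : 1 < ‖a‖) (hb : b ^ 2 = 1 - a)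
    (h4 : 4 ≤ ‖a‖) (hb0 : b ≠ 0) :
    phi a '' closedBall (1 / b) (1 / (4 * ‖b‖)) = closedBall (1 / b) (‖b‖ / 8) := by
  have hn := norm_sq_eq_of_sq_eq_one_sub ha hb
  have hbpos : 0 < ‖b‖ := norm_pos_iff.2 hb0
  have hc : ‖1 / b - 1 / b‖ ≤ 1 / (4 * ‖b‖) := by
    rw [sub_self, norm_zero]
    positivity
  have hmaps : ∀ x, ‖x - 1 / b‖ ≤ 1 / (4 * ‖b‖) → ‖phi a x - 1 / b‖ ≤ ‖b‖ / 8 := by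
    intro x hx
    have h := norm_phi_sub_phi ha hb h4 hb0 hx hc
    rw [phi_one_div hb0 hb] at h
    rw [h, ← hn]
    calc ‖b‖ ^ 2 / 2 * ‖x - 1 / b‖ ≤ ‖b‖ ^ 2 / 2 * (1 / (4 * ‖b‖)) := by gcongr
      _ = ‖b‖ / 8 := by
        field_simp
        norm_num
  apply Subset.antisymm
  · rintro _ ⟨x, hx, rfl⟩
    rw [mem_closedBall, dist_eq_norm] at hx ⊢
    exact hmaps x hx
  · intro z hz
    rw [mem_closedBall, dist_eq_norm] at hz
    have hD := norm_two_mul_sub_one h4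
    have hDpos : 0 < ‖2 * a - 1‖ := by
      rw [hD]
      linarith
    have hD0 : 2 * a - 1 ≠ 0 := norm_pos_iff.1 hDpos
    set s : Set ℚ_[2] := closedBall (1 / b) (1 / (4 * ‖b‖)) with hs
    set g : ℚ_[2] → ℚ_[2] := fun x => x - (phi a x - z) / (2 * a - 1) with hg
    have hgs : MapsTo g s s := by
      intro x hx
      rw [hs, mem_closedBall, dist_eq_norm] at hx ⊢
      have h1 : g x - 1 / b =
          (x - 1 / b) + ((z - 1 / b) + -(phi a x - 1 / b)) / (2 * a - 1) := by
        simp only [hg]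
        ring
      rw [h1]
      refine (Padic.nonarchimedean _ _).trans (max_le hx ?_)
      rw [norm_div, div_le_iff₀ hDpos, hD, ← hn]
      have h2 : 1 / (4 * ‖b‖) * (‖b‖ ^ 2 / 2) = ‖b‖ / 8 := by
        field_simp
        norm_num
      rw [h2]
      refine (Padic.nonarchimedean _ _).trans (max_le hz ?_)
      rw [norm_neg]
      exact hmaps x hx
    have hcontr : ContractingWith (1 / 2) (hgs.restrict g s s) := by
      refine ⟨by rw [← NNReal.coe_lt_coe]; norm_num, LipschitzWith.of_dist_le_mul ?_⟩
      rintro ⟨x, hx⟩ ⟨y, hy⟩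
      rw [hs, mem_closedBall, dist_eq_norm] at hx hy
      have h := norm_phi_sub_linear_le hb0 hb hx hy
      change dist (g x) (g y) ≤ _ * dist x y
      rw [dist_eq_norm, dist_eq_norm]
      have h1 : g x - g y =
          -(phi a x - phi a y - (2 * a - 1) * (x - y)) / (2 * a - 1) := by
        simp only [hg]
        field_simp
        ring
      rw [h1, norm_div, norm_neg, div_le_iff₀ hDpos, hD, ← hn]
      push_cast
      linarith
    have hcs : (1 / b) ∈ s := by
      rw [hs, mem_closedBall, dist_eq_norm]
      exact hc
    obtain ⟨x, hx, hfix, -⟩ := hcontr.exists_fixedPoint' isClosed_closedBall.isComplete hgs hcs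
      (edist_ne_top _ _)
    refine ⟨x, hx, ?_⟩
    have hfx : x - (phi a x - z) / (2 * a - 1) = x := hfix
    rw [sub_eq_self, div_eq_zero_iff] at hfx
    exact sub_eq_zero.1 (hfx.resolve_right hD0)

theorem stmt_3 (a b : ℚ_[2]) (ha : 1 < ‖a‖) (hb : b ^ 2 = 1 - a) :
    (∀ x y : ℚ_[2],
      ((x ∈ closedBall (1 / b) (1 / (4 * Real.sqrt ‖a‖)) ∧
        y ∈ closedBall (1 / b) (1 / (4 * Real.sqrt ‖a‖))) ∨
       (x ∈ closedBall (-(1 / b)) (1 / (4 * Real.sqrt ‖a‖)) ∧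
        y ∈ closedBall (-(1 / b)) (1 / (4 * Real.sqrt ‖a‖)))) →
      ‖phi a x - phi a y‖ = ‖a‖ / 2 * ‖x - y‖) ∧
    phi a '' closedBall (1 / b) (1 / (4 * Real.sqrt ‖a‖)) =
      closedBall (1 / b) (Real.sqrt ‖a‖ / 8) ∧
    phi a '' closedBall (-(1 / b)) (1 / (4 * Real.sqrt ‖a‖)) =
      closedBall (1 / b) (Real.sqrt ‖a‖ / 8) := by
  have hn := norm_sq_eq_of_sq_eq_one_sub ha hb
  have hr : Real.sqrt ‖a‖ = ‖b‖ := by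
    rw [← hn]
    exact Real.sqrt_sq (norm_nonneg b)
  have h1 : 1 < ‖b‖ := by
    by_contra! h
    nlinarith [norm_nonneg b]
  have h2 := two_le_norm_of_one_lt h1
  have h4 : 4 ≤ ‖a‖ := by nlinarith
  have hb0 : b ≠ 0 := norm_pos_iff.1 (by linarith)
  have hneg : ∀ x : ℚ_[2], ‖x - -(1 / b)‖ = ‖-x - 1 / b‖ := by
    intro x
    rw [← norm_neg]
    congr 1
    ring
  rw [hr]
  have himg := image_phi_closedBall ha hb h4 hb0
  refine ⟨?_, himg, ?_⟩
  · simp only [mem_closedBall, dist_eq_norm]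
    rintro x y (⟨hx, hy⟩ | ⟨hx, hy⟩)
    · exact norm_phi_sub_phi ha hb h4 hb0 hx hy
    · rw [hneg] at hx hy
      have h := norm_phi_sub_phi ha hb h4 hb0 hx hy
      rwa [phi_neg, phi_neg, neg_sub_neg, neg_sub_neg, norm_sub_rev, norm_sub_rev y x] at h
  · have hclose : ‖-(1 / b) - 1 / b‖ ≤ ‖b‖ / 8 := by
      have h : -(1 / b) - 1 / b = -(2 * (1 / b)) := by ring
      rw [h, norm_neg, norm_mul, norm_two_padic_two, norm_div, norm_one, ← mul_div_assoc, mul_one,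
        div_le_iff₀ (by linarith)]
      nlinarith
    have hstep : ∀ z : ℚ_[2], ‖z - 1 / b‖ ≤ ‖b‖ / 8 → ‖-z - 1 / b‖ ≤ ‖b‖ / 8 := by
      intro z hz
      have h : -z - 1 / b = -(z - 1 / b) + (-(1 / b) - 1 / b) := by ring
      rw [h]
      refine (Padic.nonarchimedean _ _).trans (max_le ?_ hclose)
      rwa [norm_neg]
    apply Subset.antisymm
    · rintro _ ⟨x, hx, rfl⟩
      rw [mem_closedBall, dist_eq_norm, hneg, ← dist_eq_norm, ← mem_closedBall] at hx
      have h := himg.subset (mem_image_of_mem (phi a) hx)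
      rw [mem_closedBall, dist_eq_norm] at h ⊢
      have h' := hstep _ h
      rwa [phi_neg, neg_neg] at h'
    · intro z hz
      rw [mem_closedBall, dist_eq_norm] at hz
      have hz' : -z ∈ closedBall (1 / b) (‖b‖ / 8) := by
        rw [mem_closedBall, dist_eq_norm]
        exact hstep z hz
      obtain ⟨x, hx, hxz⟩ := himg.superset hz'
      refine ⟨-x, ?_, by rw [phi_neg, hxz, neg_neg]⟩
      rw [mem_closedBall, dist_eq_norm] at hx ⊢
      rwa [hneg, neg_neg]
end

section
/- Let a ∈ ℚ₂ with a ≠ 0 and ‖a‖ = 2^(-v) for an integer v ≥ 1. Let i be an integer with 2·|i| ≤ v - 1. Then: (1) every x ∈ ℚ₂ with ‖x‖ = 2^i satisfies ‖φ(x)‖ = 2^(-i); (2) for all x, y ∈ ℚ₂ with ‖x‖ ∈ {2^i, 2^(-i)} and ‖y‖ ∈ {2^i, 2^(-i)}, one has ‖φ(φ(x)) - φ(φ(y))‖ ≤ ‖x - y‖ (the second iterate φ² is 1-Lipschitz on S(0,2^i) ∪ S(0,2^(-i))). -/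
theorem norm_phi_of_norm_mul_lt {a x : ℚ_[2]} (h : ‖a * x‖ < ‖x⁻¹‖) :
    ‖phi a x‖ = ‖x‖⁻¹ := by
  rw [phi, Padic.add_eq_max_of_ne h.ne, max_eq_right h.le, norm_inv]

theorem norm_phi_sub_phi_le {a x y : ℚ_[2]} (hx : x ≠ 0) (hy : y ≠ 0)
    (h : ‖a‖ ≤ ‖(x * y)⁻¹‖) : ‖phi a x - phi a y‖ ≤ ‖x - y‖ * ‖(x * y)⁻¹‖ := by
  have key : phi a x - phi a y = (x - y) * (a - (x * y)⁻¹) := by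
    unfold phi
    field_simp
    ring
  rw [key, norm_mul]
  gcongr
  rw [sub_eq_add_neg]
  refine (Padic.nonarchimedean _ _).trans ?_
  rw [norm_neg]
  exact max_le h le_rfl

theorem norm_phi_of_norm_eq_zpow {a : ℚ_[2]} {v j : ℤ} (ha : ‖a‖ = (2 : ℝ) ^ (-v))
    (hj : 2 * j < v) {x : ℚ_[2]} (hx : ‖x‖ = (2 : ℝ) ^ j) :
    ‖phi a x‖ = (2 : ℝ) ^ (-j) := by
  rw [norm_phi_of_norm_mul_lt, hx, zpow_neg]
  rw [norm_mul, norm_inv, ha, hx, ← zpow_neg, ← zpow_add₀ two_ne_zero]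
  exact zpow_lt_zpow_right₀ one_lt_two (by omega)

theorem norm_phi_sub_phi_le_zpow {a : ℚ_[2]} {v j k : ℤ} (ha : ‖a‖ = (2 : ℝ) ^ (-v))
    (hjk : j + k ≤ v) {x y : ℚ_[2]} (hx : ‖x‖ = (2 : ℝ) ^ j) (hy : ‖y‖ = (2 : ℝ) ^ k) :
    ‖phi a x - phi a y‖ ≤ ‖x - y‖ * (2 : ℝ) ^ (-(j + k)) := by
  have hx0 : x ≠ 0 := norm_pos_iff.mp (hx ▸ by positivity)
  have hy0 : y ≠ 0 := norm_pos_iff.mp (hy ▸ by positivity)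
  have hxy : ‖(x * y)⁻¹‖ = (2 : ℝ) ^ (-(j + k)) := by
    rw [norm_inv, norm_mul, hx, hy, ← zpow_add₀ two_ne_zero, zpow_neg]
  rw [← hxy]
  refine norm_phi_sub_phi_le hx0 hy0 ?_
  rw [hxy, ha]
  exact zpow_le_zpow_right₀ one_le_two (by omega)

theorem norm_phi_phi_sub_le {a : ℚ_[2]} {v j k : ℤ} (ha : ‖a‖ = (2 : ℝ) ^ (-v))
    (hj : 2 * |j| < v) (hk : 2 * |k| < v) {x y : ℚ_[2]}
    (hx : ‖x‖ = (2 : ℝ) ^ j) (hy : ‖y‖ = (2 : ℝ) ^ k) :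
    ‖phi a (phi a x) - phi a (phi a y)‖ ≤ ‖x - y‖ := by
  have hj₁ := le_abs_self j
  have hj₂ := neg_le_abs j
  have hk₁ := le_abs_self k
  have hk₂ := neg_le_abs k
  calc ‖phi a (phi a x) - phi a (phi a y)‖
      ≤ ‖phi a x - phi a y‖ * (2 : ℝ) ^ (-(-j + -k)) :=
        norm_phi_sub_phi_le_zpow ha (by omega)
          (norm_phi_of_norm_eq_zpow ha (by omega) hx) (norm_phi_of_norm_eq_zpow ha (by omega) hy)
    _ ≤ ‖x - y‖ * (2 : ℝ) ^ (-(j + k)) * (2 : ℝ) ^ (-(-j + -k)) := by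
        gcongr
        exact norm_phi_sub_phi_le_zpow ha (by omega) hx hy
    _ = ‖x - y‖ := by
        rw [mul_assoc, ← zpow_add₀ two_ne_zero, ← neg_add j k, neg_neg, neg_add_cancel, zpow_zero,
          mul_one]

theorem stmt_7 (a : ℚ_[2]) (ha0 : a ≠ 0) (v : ℤ) (hv : 1 ≤ v)
    (ha : ‖a‖ = (2 : ℝ) ^ (-v)) (i : ℤ) (hi : 2 * |i| ≤ v - 1) :
    (∀ x : ℚ_[2], ‖x‖ = (2 : ℝ) ^ i → ‖phi a x‖ = (2 : ℝ) ^ (-i)) ∧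
    (∀ x y : ℚ_[2],
      (‖x‖ = (2 : ℝ) ^ i ∨ ‖x‖ = (2 : ℝ) ^ (-i)) →
      (‖y‖ = (2 : ℝ) ^ i ∨ ‖y‖ = (2 : ℝ) ^ (-i)) →
      ‖phi a (phi a x) - phi a (phi a y)‖ ≤ ‖x - y‖) := by
  have hi₁ : 2 * |i| < v := by omega
  have hi₂ : 2 * |-i| < v := by rwa [abs_neg]
  refine ⟨fun x hx => norm_phi_of_norm_eq_zpow ha (by linarith [le_abs_self i]) hx, ?_⟩
  rintro x y (hx | hx) (hy | hy)
  · exact norm_phi_phi_sub_le ha hi₁ hi₁ hx hy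
  · exact norm_phi_phi_sub_le ha hi₁ hi₂ hx hy
  · exact norm_phi_phi_sub_le ha hi₂ hi₁ hx hy
  · exact norm_phi_phi_sub_le ha hi₂ hi₂ hx hy
end

section
/- Let a ∈ ℚ₂ with a ≠ 0 and ‖a‖ < 1, and let X_a = {x ∈ ℚ₂ : √‖a‖ < ‖x‖ < 1/√‖a‖}. Then X_a is invariant under φ: for every x ∈ X_a, ‖φ(x)‖ = 1/‖x‖ and φ(x) ∈ X_a. -/
theorem stmt_8 (a : ℚ_[2]) (ha0 : a ≠ 0) (ha : ‖a‖ < 1) (x : ℚ_[2])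
    (hx : x ∈ {y : ℚ_[2] | Real.sqrt ‖a‖ < ‖y‖ ∧ ‖y‖ < 1 / Real.sqrt ‖a‖}) :
    ‖phi a x‖ = 1 / ‖x‖ ∧
    phi a x ∈ {y : ℚ_[2] | Real.sqrt ‖a‖ < ‖y‖ ∧ ‖y‖ < 1 / Real.sqrt ‖a‖} := by
  obtain ⟨hx1, hx2⟩ := hx
  have hs : 0 < Real.sqrt ‖a‖ := Real.sqrt_pos.2 (norm_pos_iff.2 ha0)
  have hxpos : 0 < ‖x‖ := hs.trans hx1
  rw [lt_div_iff₀ hs] at hx2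
  have hlt : ‖a * x‖ < ‖x⁻¹‖ := by
    rw [norm_mul, norm_inv, ← one_div, lt_div_iff₀ hxpos]
    calc ‖a‖ * ‖x‖ * ‖x‖ = (‖x‖ * Real.sqrt ‖a‖) ^ 2 := by
          rw [mul_pow, Real.sq_sqrt (norm_nonneg a)]; ring
      _ < 1 := pow_lt_one₀ (by positivity) hx2 two_ne_zero
  have hnorm : ‖phi a x‖ = 1 / ‖x‖ := by
    rw [phi, Padic.add_eq_max_of_ne hlt.ne, max_eq_right hlt.le, norm_inv, one_div]
  refine ⟨hnorm, ?_, ?_⟩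
  · rw [hnorm, lt_div_iff₀ hxpos, mul_comm]
    exact hx2
  · rw [hnorm]
    exact one_div_lt_one_div_of_lt hs hx1
end

section
/- Let a ∈ ℚ₂ with a ≠ 0 and ‖a‖ = 2^(-(2m+1)) for some integer m ≥ 0 (i.e. the 2-adic valuation of a is odd and positive). Then for every x ∈ ℚ₂ with x ≠ 0 there exist N ∈ ℕ and an integer i with 0 ≤ i ≤ m such that for all n ≥ N, ‖φ^[n](x)‖ = 2^i or ‖φ^[n](x)‖ = 2^(-i). -/
/-- The action of `phi a` on the exponents of norms, when `‖a‖ = 2 ^ (-(2 * m + 1))`. -/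
def normExponentMap (m : ℕ) (k : ℤ) : ℤ := max (k - (2 * m + 1)) (-k)

theorem norm_phi_eq {a x : ℚ_[2]} {m : ℕ} {k : ℤ}
    (ha : ‖a‖ = (2 : ℝ) ^ (-(2 * (m : ℤ) + 1))) (hx : ‖x‖ = (2 : ℝ) ^ k) :
    ‖phi a x‖ = (2 : ℝ) ^ normExponentMap m k := by
  have h₁ : ‖a * x‖ = (2 : ℝ) ^ (k - (2 * (m : ℤ) + 1)) := by
    rw [norm_mul, ha, hx, ← zpow_add₀ two_ne_zero, sub_eq_neg_add]
  have h₂ : ‖x⁻¹‖ = (2 : ℝ) ^ (-k) := by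
    rw [norm_inv, hx, zpow_neg]
  have hmono : StrictMono fun n : ℤ => (2 : ℝ) ^ n := zpow_right_strictMono₀ one_lt_two
  have hne : ‖a * x‖ ≠ ‖x⁻¹‖ := by
    rw [h₁, h₂]
    intro h
    have := hmono.injective h
    omega
  rw [phi, Padic.add_eq_max_of_ne hne, h₁, h₂, normExponentMap]
  exact (hmono.monotone.map_max).symm

theorem norm_iterate_phi_eq {a x : ℚ_[2]} {m : ℕ} {k : ℤ}
    (ha : ‖a‖ = (2 : ℝ) ^ (-(2 * (m : ℤ) + 1))) (hx : ‖x‖ = (2 : ℝ) ^ k) (n : ℕ) :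
    ‖(phi a)^[n] x‖ = (2 : ℝ) ^ (normExponentMap m)^[n] k := by
  induction n with
  | zero => exact hx
  | succ n ih =>
    rw [Function.iterate_succ_apply', Function.iterate_succ_apply']
    exact norm_phi_eq ha ih

theorem iterate_normExponentMap_of_abs_le {m : ℕ} {k : ℤ} (hk : |k| ≤ m) (n : ℕ) :
    |(normExponentMap m)^[n] k| = |k| := by
  induction n with
  | zero => rfl
  | succ n ih =>
    rw [Function.iterate_succ_apply']
    generalize (normExponentMap m)^[n] k = l at ih ⊢
    have hl : |l| ≤ m := ih.trans_le hk
    rw [abs_le] at hl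
    rw [normExponentMap, max_eq_right (by omega), abs_neg, ih]

theorem exists_abs_iterate_normExponentMap_le_of_neg_le {m : ℕ} {k : ℤ} (hk : -(m : ℤ) ≤ k) :
    ∃ N, |(normExponentMap m)^[N] k| ≤ m := by
  by_cases hkm : k ≤ m
  · exact ⟨0, abs_le.mpr ⟨hk, hkm⟩⟩
  · have hstep : normExponentMap m k = k - (2 * m + 1) := max_eq_left (by omega)
    obtain ⟨N, hN⟩ := exists_abs_iterate_normExponentMap_le_of_neg_le
      (m := m) (k := k - (2 * m + 1)) (by omega)
    exact ⟨N + 1, by rwa [Function.iterate_succ_apply, hstep]⟩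
termination_by (k + m).toNat
decreasing_by omega

theorem exists_abs_iterate_normExponentMap_le (m : ℕ) (k : ℤ) :
    ∃ N, |(normExponentMap m)^[N] k| ≤ m := by
  by_cases hk : -(m : ℤ) ≤ k
  · exact exists_abs_iterate_normExponentMap_le_of_neg_le hk
  · have hstep : -(m : ℤ) ≤ normExponentMap m k := le_max_of_le_right (by omega)
    obtain ⟨N, hN⟩ := exists_abs_iterate_normExponentMap_le_of_neg_le hstep
    exact ⟨N + 1, hN⟩

theorem stmt_12 (a : ℚ_[2]) (ha0 : a ≠ 0) (m : ℕ)
    (ha : ‖a‖ = (2 : ℝ) ^ (-(2 * (m : ℤ) + 1)))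
    (x : ℚ_[2]) (hx : x ≠ 0) :
    ∃ (N : ℕ) (i : ℤ), 0 ≤ i ∧ i ≤ m ∧
      ∀ n ≥ N, ‖(phi a)^[n] x‖ = (2 : ℝ) ^ i ∨ ‖(phi a)^[n] x‖ = (2 : ℝ) ^ (-i) := by
  have hxk : ‖x‖ = (2 : ℝ) ^ (-x.valuation) := by
    simpa using Padic.norm_eq_zpow_neg_valuation hx
  obtain ⟨N, hN⟩ := exists_abs_iterate_normExponentMap_le m (-x.valuation)
  refine ⟨N, _, abs_nonneg _, hN, fun n hn => ?_⟩
  obtain ⟨d, rfl⟩ := Nat.exists_eq_add_of_le' hn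
  have habs := iterate_normExponentMap_of_abs_le hN d
  rw [← Function.iterate_add_apply] at habs
  rw [norm_iterate_phi_eq ha hxk, ← habs]
  rcases abs_choice ((normExponentMap m)^[d + N] (-x.valuation)) with h | h
  · left; rw [h]
  · right; rw [h, neg_neg]
end

section
/- Let a ∈ ℚ₂ with a ≠ 0 and ‖a‖ = 2^(-2m) for an integer m ≥ 1 (even positive 2-adic valuation). Assume there is no b ∈ ℚ₂ with b² = -a, and assume moreover that m ≠ 1 or there is no c ∈ ℚ₂ with a = 3·c² (i.e. the 2-adic valuation of a is not 2, or ℚ₂(√(-a)) ≠ ℚ₂(√(-3))). Then for every x ∈ ℚ₂ with x ≠ 0 there exist N ∈ ℕ and an integer i with 0 ≤ i ≤ m - 1 such that for all n ≥ N, ‖φ^[n](x)‖ = 2^i or ‖φ^[n](x)‖ = 2^(-i). -/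
namespace Padic

lemma norm_two_eq : ‖(2 : ℚ_[2])‖ = 1 / 2 := by
  simpa using Padic.norm_p (p := 2)

lemma norm_odd_natCast {n : ℕ} (hn : Odd n) : ‖(n : ℚ_[2])‖ = 1 :=
  Padic.norm_natCast_eq_one_iff.2 (Nat.coprime_two_left.2 hn)

lemma norm_add_eq_left {p : ℕ} [Fact p.Prime] {u v : ℚ_[p]} (h : ‖v‖ < ‖u‖) :
    ‖u + v‖ = ‖u‖ := by
  rw [Padic.add_eq_max_of_ne h.ne', max_eq_left h.le]

/-- A 2-adic number congruent to `1` modulo `8` is a square. -/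
lemma isSquare_of_norm_sub_one_le {w : ℚ_[2]} (hw : ‖w - 1‖ ≤ 1 / 8) : IsSquare w := by
  have hw1 : ‖w‖ ≤ 1 := by
    have := Padic.nonarchimedean (w - 1) 1
    rw [sub_add_cancel, norm_one] at this
    exact this.trans (max_le (by linarith) le_rfl)
  have h2 : ‖(2 : ℤ_[2])‖ = 1 / 2 := by simpa using PadicInt.norm_p (p := 2)
  obtain ⟨v, rfl⟩ : ∃ v : ℤ_[2], (v : ℚ_[2]) = w := ⟨⟨w, hw1⟩, rfl⟩
  have hv : ‖1 - v‖ ≤ 1 / 8 := by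
    rw [norm_sub_rev, PadicInt.norm_def]
    exact_mod_cast hw
  obtain ⟨z, hz, -⟩ := hensels_lemma (p := 2) (R := ℤ_[2])
    (F := Polynomial.X ^ 2 - Polynomial.C v) (a := 1) (by
      simp only [Polynomial.coe_aeval_eq_eval, Polynomial.eval_sub, Polynomial.eval_pow,
        Polynomial.eval_X, Polynomial.eval_C, one_pow, Polynomial.derivative_sub,
        Polynomial.derivative_X_pow, Polynomial.derivative_C, sub_zero, Polynomial.eval_mul]
      norm_num [h2]
      linarith)
  simp only [Polynomial.coe_aeval_eq_eval, Polynomial.eval_sub, Polynomial.eval_pow,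
    Polynomial.eval_X, Polynomial.eval_C, sub_eq_zero] at hz
  refine ⟨z, ?_⟩
  rw [← hz]
  push_cast
  ring

/-- Every 2-adic integer is congruent modulo `8` to a natural number below `8`. -/
lemma exists_nat_norm_sub_le {w : ℚ_[2]} (hw : ‖w‖ ≤ 1) :
    ∃ n < 8, ‖w - (n : ℕ)‖ ≤ 1 / 8 := by
  refine ⟨PadicInt.appr ⟨w, hw⟩ 3, PadicInt.appr_lt _ 3, ?_⟩
  have := (PadicInt.norm_le_pow_iff_mem_span_pow _ 3).2 (PadicInt.appr_spec 3 ⟨w, hw⟩)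
  have h8 : ((2 : ℕ) : ℝ) ^ (-(3 : ℕ) : ℤ) = 1 / 8 := by norm_num
  rw [h8] at this
  exact_mod_cast this

lemma norm_one_add_of_norm_eq_one {w : ℚ_[2]} (hw : ‖w‖ = 1) :
    ‖1 + w‖ = 1 / 2 ∨ (‖1 + w‖ = 1 / 4 ∧ IsSquare (w / 3)) ∨ IsSquare (-w) := by
  obtain ⟨n, hn, hwn⟩ := exists_nat_norm_sub_le hw.le
  have h3 : ‖(3 : ℚ_[2])‖ = 1 := by exact_mod_cast norm_odd_natCast (n := 3) (by decide)
  have hnorm : ‖((n : ℕ) : ℚ_[2])‖ = 1 := by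
    have := norm_add_eq_left (u := w) (v := -(w - n)) (by rw [norm_neg, hw]; linarith)
    rwa [hw, neg_sub, add_sub_cancel] at this
  have hodd : Odd n := Nat.coprime_two_left.1 (Padic.norm_natCast_eq_one_iff.1 hnorm)
  have key : ∀ r : ℝ, 1 / 8 < r → ‖(1 + n : ℚ_[2])‖ = r → ‖1 + w‖ = r := by
    intro r hr h
    rw [show 1 + w = (1 + n : ℚ_[2]) + (w - n) by ring, norm_add_eq_left (by linarith), h]
  interval_cases n
  all_goals try exact absurd hodd (by decide)
  · refine .inl (key _ (by norm_num) ?_)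
    norm_num [norm_two_eq]
  · refine .inr (.inl ⟨key _ (by norm_num) ?_, isSquare_of_norm_sub_one_le ?_⟩)
    · rw [show (1 + (3 : ℕ) : ℚ_[2]) = 2 * 2 by norm_num, norm_mul, norm_two_eq]
      norm_num
    · rw [show w / 3 - 1 = (w - (3 : ℕ)) / 3 by push_cast; ring, norm_div, h3, div_one]
      exact hwn
  · refine .inl (key _ (by norm_num) ?_)
    rw [show (1 + (5 : ℕ) : ℚ_[2]) = 2 * 3 by norm_num, norm_mul, norm_two_eq, h3]
    norm_num
  · refine .inr (.inr (isSquare_of_norm_sub_one_le ?_))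
    rw [show -w - 1 = -(w - (7 : ℕ)) + -(2 * 2 * 2) by push_cast; ring]
    refine (Padic.nonarchimedean _ _).trans (max_le (by rwa [norm_neg]) ?_)
    rw [norm_neg, norm_mul, norm_mul, norm_two_eq]
    norm_num

end Padic

section Dynamics

variable {a x : ℚ_[2]} {m k : ℤ}

lemma norm_phi_of_lt (ha : ‖a‖ = (2 : ℝ) ^ (-(2 * m))) (hx : ‖x‖ = (2 : ℝ) ^ k) (hk : k < m) :
    ‖phi a x‖ = (2 : ℝ) ^ (-k) := by
  have hinv : ‖x⁻¹‖ = (2 : ℝ) ^ (-k) := by rw [norm_inv, hx, zpow_neg]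
  have hax : ‖a * x‖ = (2 : ℝ) ^ (-(2 * m) + k) := by
    rw [norm_mul, ha, hx, zpow_add₀ two_ne_zero]
  rw [phi, add_comm, Padic.norm_add_eq_left, hinv]
  rw [hinv, hax]
  exact zpow_lt_zpow_right₀ one_lt_two (by lia)

lemma norm_phi_of_gt (ha : ‖a‖ = (2 : ℝ) ^ (-(2 * m))) (hx : ‖x‖ = (2 : ℝ) ^ k) (hk : m < k) :
    ‖phi a x‖ = (2 : ℝ) ^ (k - 2 * m) := by
  have hinv : ‖x⁻¹‖ = (2 : ℝ) ^ (-k) := by rw [norm_inv, hx, zpow_neg]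
  have hax : ‖a * x‖ = (2 : ℝ) ^ (k - 2 * m) := by
    rw [norm_mul, ha, hx, ← zpow_add₀ two_ne_zero]
    congr 1
    ring
  rw [phi, Padic.norm_add_eq_left, hax]
  rw [hinv, hax]
  exact zpow_lt_zpow_right₀ one_lt_two (by lia)

lemma norm_phi_of_eq (hm : 1 ≤ m) (ha : ‖a‖ = (2 : ℝ) ^ (-(2 * m)))
    (hsq : ¬ ∃ b : ℚ_[2], b ^ 2 = -a) (hcase : m ≠ 1 ∨ ¬ ∃ c : ℚ_[2], a = 3 * c ^ 2)
    (hx : ‖x‖ = (2 : ℝ) ^ m) :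
    ∃ j : ℤ, m < j ∧ j < 3 * m ∧ ‖phi a x‖ = (2 : ℝ) ^ (-j) := by
  have hx0 : x ≠ 0 := by
    rw [← norm_pos_iff, hx]
    positivity
  have hw : ‖a * x ^ 2‖ = 1 := by
    rw [norm_mul, norm_pow, ha, hx, ← zpow_natCast, ← zpow_mul, ← zpow_add₀ two_ne_zero]
    ring_nf
    norm_num
  have hphi : phi a x = (1 + a * x ^ 2) * x⁻¹ := by
    rw [phi]
    field_simp
    ring
  have hnorm : ‖phi a x‖ = ‖1 + a * x ^ 2‖ * (2 : ℝ) ^ (-m) := by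
    rw [hphi, norm_mul, norm_inv, hx, zpow_neg]
  rcases Padic.norm_one_add_of_norm_eq_one hw with h | ⟨h, c, hc⟩ | ⟨b, hb⟩
  · refine ⟨m + 1, by lia, by lia, ?_⟩
    rw [hnorm, h, neg_add, zpow_add₀ two_ne_zero]
    norm_num
    ring
  · have hm1 : m ≠ 1 := hcase.resolve_right fun h' ↦ h' ⟨c / x, by
      field_simp at hc ⊢
      linear_combination hc⟩
    refine ⟨m + 2, by lia, by lia, ?_⟩
    rw [hnorm, h, neg_add, zpow_add₀ two_ne_zero]
    norm_num
    ring
  · refine absurd ⟨b / x, ?_⟩ hsq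
    field_simp
    linear_combination -hb

/-- The orbit of `x` is eventually contained in the union of two spheres of radii `2 ^ i` and
`2 ^ (-i)` with `0 ≤ i ≤ m - 1`. -/
def EventuallyOnSpheres (a : ℚ_[2]) (m : ℤ) (x : ℚ_[2]) : Prop :=
  ∃ (N : ℕ) (i : ℤ), 0 ≤ i ∧ i ≤ m - 1 ∧
    ∀ n ≥ N, ‖(phi a)^[n] x‖ = (2 : ℝ) ^ i ∨ ‖(phi a)^[n] x‖ = (2 : ℝ) ^ (-i)

lemma EventuallyOnSpheres.of_phi (h : EventuallyOnSpheres a m (phi a x)) :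
    EventuallyOnSpheres a m x := by
  obtain ⟨N, i, hi0, him, h⟩ := h
  refine ⟨N + 1, i, hi0, him, fun n hn ↦ ?_⟩
  obtain ⟨n, rfl⟩ : ∃ l, n = l + 1 := ⟨n - 1, by lia⟩
  exact h n (by lia)

lemma eventuallyOnSpheres_of_abs_lt (ha : ‖a‖ = (2 : ℝ) ^ (-(2 * m)))
    (hx : ‖x‖ = (2 : ℝ) ^ k) (hk : |k| < m) : EventuallyOnSpheres a m x := by
  rw [abs_lt] at hk
  have horbit (n : ℕ) :
      ‖(phi a)^[n] x‖ = (2 : ℝ) ^ k ∨ ‖(phi a)^[n] x‖ = (2 : ℝ) ^ (-k) := by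
    induction n with
    | zero => exact .inl hx
    | succ n ih =>
      rw [Function.iterate_succ_apply']
      rcases ih with h | h
      · exact .inr (norm_phi_of_lt ha h hk.2)
      · exact .inl (by simpa using norm_phi_of_lt ha h (by lia))
  rcases abs_cases k with ⟨h, _⟩ | ⟨h, _⟩
  · exact ⟨0, k, by lia, by lia, fun n _ ↦ horbit n⟩
  · refine ⟨0, -k, by lia, by lia, fun n _ ↦ ?_⟩
    rw [neg_neg]
    exact (horbit n).symm

lemma eventuallyOnSpheres_of_lt_three_mul (ha : ‖a‖ = (2 : ℝ) ^ (-(2 * m)))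
    (hx : ‖x‖ = (2 : ℝ) ^ k) (hk : m < k) (hk' : k < 3 * m) : EventuallyOnSpheres a m x :=
  .of_phi (eventuallyOnSpheres_of_abs_lt ha (norm_phi_of_gt ha hx hk) (by rw [abs_lt]; lia))

lemma eventuallyOnSpheres_of_eq (hm : 1 ≤ m) (ha : ‖a‖ = (2 : ℝ) ^ (-(2 * m)))
    (hsq : ¬ ∃ b : ℚ_[2], b ^ 2 = -a) (hcase : m ≠ 1 ∨ ¬ ∃ c : ℚ_[2], a = 3 * c ^ 2)
    (hx : ‖x‖ = (2 : ℝ) ^ m) : EventuallyOnSpheres a m x := by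
  obtain ⟨j, hmj, hj, h⟩ := norm_phi_of_eq hm ha hsq hcase hx
  refine .of_phi (.of_phi (eventuallyOnSpheres_of_lt_three_mul ha ?_ hmj hj))
  simpa using norm_phi_of_lt ha h (by lia)

lemma eventuallyOnSpheres_of_neg_le (hm : 1 ≤ m) (ha : ‖a‖ = (2 : ℝ) ^ (-(2 * m)))
    (hsq : ¬ ∃ b : ℚ_[2], b ^ 2 = -a) (hcase : m ≠ 1 ∨ ¬ ∃ c : ℚ_[2], a = 3 * c ^ 2)
    (hx : ‖x‖ = (2 : ℝ) ^ k) (hk : -m ≤ k) : EventuallyOnSpheres a m x := by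
  induction hl : k.toNat using Nat.strong_induction_on generalizing k x with
  | _ l ih =>
    rcases lt_trichotomy k m with h | rfl | h
    · rcases hk.eq_or_lt with rfl | hk
      · refine .of_phi (eventuallyOnSpheres_of_eq hm ha hsq hcase ?_)
        simpa using norm_phi_of_lt ha hx h
      · exact eventuallyOnSpheres_of_abs_lt ha hx (abs_lt.2 ⟨hk, h⟩)
    · exact eventuallyOnSpheres_of_eq hm ha hsq hcase hx
    · exact .of_phi (ih _ (by lia) (norm_phi_of_gt ha hx h) (by lia) rfl)

end Dynamics

theorem stmt_13 (a : ℚ_[2]) (ha0 : a ≠ 0) (m : ℤ) (hm : 1 ≤ m)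
    (ha : ‖a‖ = (2 : ℝ) ^ (-(2 * m)))
    (hsq : ¬ ∃ b : ℚ_[2], b ^ 2 = -a)
    (hcase : m ≠ 1 ∨ ¬ ∃ c : ℚ_[2], a = 3 * c ^ 2)
    (x : ℚ_[2]) (hx : x ≠ 0) :
    ∃ (N : ℕ) (i : ℤ), 0 ≤ i ∧ i ≤ m - 1 ∧
      ∀ n ≥ N, ‖(phi a)^[n] x‖ = (2 : ℝ) ^ i ∨ ‖(phi a)^[n] x‖ = (2 : ℝ) ^ (-i) := by
  obtain ⟨k, hk⟩ : ∃ k : ℤ, ‖x‖ = (2 : ℝ) ^ k :=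
    ⟨-x.valuation, by exact_mod_cast Padic.norm_eq_zpow_neg_valuation hx⟩
  change EventuallyOnSpheres a m x
  rcases le_or_gt (-m) k with h | h
  · exact eventuallyOnSpheres_of_neg_le hm ha hsq hcase hk h
  · exact .of_phi (eventuallyOnSpheres_of_neg_le hm ha hsq hcase
      (norm_phi_of_lt ha hk (by lia)) (by lia))
end

section
/- Let p be a prime, I a nonempty finite type, c : I → ℚ_p, τ : I → ℤ, and set D i = closedBall(c i, p^(-τ i)); assume the balls D i are pairwise disjoint and let X = ⋃ᵢ D i. Let f : ℚ_p → ℚ_p and γ : I → ℤ satisfy: for each i and all x, y ∈ D i, ‖f(x) - f(y)‖ = p^(γ i)·‖x - y‖; X ⊆ f '' X; (i) for each i there exists j with D j ⊆ f '' (D i); (ii) there exist i, j with D j ⊆ f '' (D i) and f '' (D i) ≠ D j. Define the incidence relation A : I → I → Prop by A i j ↔ D j ⊆ f '' (D i), and assume A is irreducible (for all i, j there exist n ≥ 1 and a finite sequence i = i₀, i₁, …, iₙ = j with A i_k i_{k+1} for all k < n). Let K = {x ∈ ℚ_p : f^[n](x) ∈ X for all n ∈ ℕ}. Then f maps K into K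 and there is a homeomorphism h : K ≃ₜ Σ_A with h(f(x)) = σ(h(x)) for all x ∈ K; moreover h can be chosen so that for all x ∈ K and n ∈ ℕ, h(x)(n) = i exactly when f^[n](x) ∈ D i. -/
open Metric Set

/-- A distance preserving self-map of a compact set is onto. -/
theorem IsCompact.surjOn_of_dist_eq {α : Type*} [MetricSpace α] {s : Set α} (hs : IsCompact s)
    {g : α → α} (hg : MapsTo g s s) (hd : ∀ x ∈ s, ∀ y ∈ s, dist (g x) (g y) = dist x y) :
    SurjOn g s s := by
  intro y hy
  by_contra hny
  have hcont : ContinuousOn g s := by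
    refine LipschitzOnWith.continuousOn (K := 1) (LipschitzOnWith.of_dist_le_mul ?_)
    intro a ha b hb
    simp [hd a ha b hb]
  have hcl : IsClosed (g '' s) := (hs.image_of_continuousOn hcont).isClosed
  obtain ⟨δ, hδ, hball⟩ := Metric.isOpen_iff.1 hcl.isOpen_compl y hny
  have hfar : ∀ z ∈ g '' s, δ ≤ dist z y := by
    intro z hz
    by_contra! hlt
    exact hball hlt hz
  have hmem : ∀ n, g^[n] y ∈ s := fun n => hg.iterate n hy
  have hsep : ∀ m n, m < n → δ ≤ dist (g^[n] y) (g^[m] y) := by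
    intro m
    induction m with
    | zero =>
      intro n hn
      obtain ⟨k, rfl⟩ := Nat.exists_eq_succ_of_ne_zero hn.ne'
      rw [Function.iterate_succ_apply']
      exact hfar _ (mem_image_of_mem _ (hmem k))
    | succ m ih =>
      intro n hn
      obtain ⟨k, rfl⟩ := Nat.exists_eq_succ_of_ne_zero (Nat.ne_zero_of_lt hn)
      rw [Function.iterate_succ_apply', Function.iterate_succ_apply', hd _ (hmem k) _ (hmem m)]
      exact ih k (by omega)
  obtain ⟨a, -, φ, hφ, hlim⟩ := hs.tendsto_subseq hmem
  obtain ⟨N, hN⟩ := Metric.cauchySeq_iff.1 hlim.cauchySeq δ hδ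
  exact absurd (hN (N + 1) (by omega) N le_rfl) (not_lt.2 (hsep _ _ (hφ (Nat.lt_succ_self N))))

/-- A map scaling distances on a `p`-adic ball by a power of `p` maps it onto a ball. -/
theorem Padic.image_closedBall_of_norm_sub_eq {p : ℕ} [Fact p.Prime] {f : ℚ_[p] → ℚ_[p]}
    {c : ℚ_[p]} {r : ℝ} (hr : 0 ≤ r) {g : ℤ}
    (hf : ∀ x ∈ closedBall c r, ∀ y ∈ closedBall c r, ‖f x - f y‖ = (p : ℝ) ^ g * ‖x - y‖) :
    f '' closedBall c r = closedBall (f c) ((p : ℝ) ^ g * r) := by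
  have hp0 : (0 : ℝ) < p := by exact_mod_cast (Fact.out : p.Prime).pos
  have hpQ : (p : ℚ_[p]) ≠ 0 := by exact_mod_cast (Fact.out : p.Prime).ne_zero
  have hc : c ∈ closedBall c r := mem_closedBall_self hr
  have hpg : (0 : ℝ) < (p : ℝ) ^ g := zpow_pos hp0 g
  have hinv : (p : ℝ) ^ (-g) * (p : ℝ) ^ g = 1 := by
    rw [← zpow_add₀ hp0.ne']; simp
  apply Subset.antisymm
  · rintro _ ⟨x, hx, rfl⟩
    rw [mem_closedBall, dist_eq_norm, hf x hx c hc]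
    rw [mem_closedBall, dist_eq_norm] at hx
    gcongr
  · intro y hy
    have hd : ∀ a ∈ closedBall c r, ∀ b ∈ closedBall c r,
        dist (c + (p : ℚ_[p]) ^ g * (f a - f c)) (c + (p : ℚ_[p]) ^ g * (f b - f c)) =
          dist a b := by
      intro a ha b hb
      rw [dist_add_left, dist_eq_norm, ← mul_sub, sub_sub_sub_cancel_right, norm_mul,
        Padic.norm_p_zpow, hf a ha b hb, ← mul_assoc, hinv, one_mul, dist_eq_norm]
    have hmaps : MapsTo (fun x => c + (p : ℚ_[p]) ^ g * (f x - f c))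
        (closedBall c r) (closedBall c r) := by
      intro a ha
      have := hd a ha c hc
      rw [sub_self, mul_zero, add_zero] at this
      rw [mem_closedBall, this]
      exact ha
    have hmem : c + (p : ℚ_[p]) ^ g * (y - f c) ∈ closedBall c r := by
      rw [mem_closedBall, dist_eq_norm] at hy ⊢
      rw [add_sub_cancel_left, norm_mul, Padic.norm_p_zpow]
      calc (p : ℝ) ^ (-g) * ‖y - f c‖ ≤ (p : ℝ) ^ (-g) * ((p : ℝ) ^ g * r) := by gcongr
        _ = r := by rw [← mul_assoc, hinv, one_mul]
    obtain ⟨x, hx, hxy⟩ := (isCompact_closedBall c r).surjOn_of_dist_eq hmaps hd hmem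
    refine ⟨x, hx, ?_⟩
    have h1 := mul_left_cancel₀ (zpow_ne_zero g hpQ) (add_left_cancel hxy)
    exact sub_left_inj.1 h1

/-- If a `p`-adic ball of radius `p ^ a` is contained in a ball of radius `p ^ b`,
then `a ≤ b`. -/
theorem Padic.le_of_closedBall_subset_closedBall {p : ℕ} [Fact p.Prime] {x y : ℚ_[p]} {a b : ℤ}
    (h : closedBall x ((p : ℝ) ^ a) ⊆ closedBall y ((p : ℝ) ^ b)) : a ≤ b := by
  have hp1 : (1 : ℝ) < p := by exact_mod_cast (Fact.out : p.Prime).one_lt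
  have hx : x ∈ closedBall x ((p : ℝ) ^ a) := mem_closedBall_self (by positivity)
  have hx' : x + (p : ℚ_[p]) ^ (-a) ∈ closedBall x ((p : ℝ) ^ a) := by
    rw [mem_closedBall, dist_eq_norm, add_sub_cancel_left, Padic.norm_p_zpow, neg_neg]
  have h1 := h hx'
  rw [IsUltrametricDist.closedBall_eq_of_mem (h hx), mem_closedBall, dist_eq_norm,
    add_sub_cancel_left, Padic.norm_p_zpow, neg_neg] at h1
  exact (zpow_le_zpow_iff_right₀ hp1).1 h1

/-- The points following an itinerary of closed sets up to time `n` form a closed set. -/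
theorem isClosed_setOf_forall_le_iterate_mem {α : Type*} [TopologicalSpace α] {f : α → α} (n : ℕ)
    (U : ℕ → Set α) (hU : ∀ k, IsClosed (U k)) (hf : ∀ k, ContinuousOn f (U k)) :
    IsClosed {x | ∀ k ≤ n, f^[k] x ∈ U k} := by
  induction n generalizing U with
  | zero => simpa using hU 0
  | succ n ih =>
    have h := (hf 0).preimage_isClosed_of_isClosed (hU 0)
      (ih (fun k => U (k + 1)) (fun k => hU _) (fun k => hf _))
    convert h using 1
    ext x
    simp only [mem_ofPred_eq, mem_inter_iff, mem_preimage]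
    constructor
    · intro hx
      exact ⟨hx 0 (by omega), fun k hk => hx (k + 1) (by omega)⟩
    · rintro ⟨h0, hx⟩ k hk
      cases k with
      | zero => exact h0
      | succ k => exact hx k (by omega)

/-- A finite itinerary each of whose sets is covered by the image of the preceding one is
realized by an orbit. -/
theorem exists_forall_le_iterate_mem {α : Type*} {f : α → α} (n : ℕ)
    (U : ℕ → Set α) (hne : ∀ k, (U k).Nonempty) (hU : ∀ k, U (k + 1) ⊆ f '' U k) :
    ∃ x, ∀ k ≤ n, f^[k] x ∈ U k := by
  induction n generalizing U with
  | zero => simpa [Set.Nonempty] using hne 0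
  | succ n ih =>
    obtain ⟨y, hy⟩ := ih (fun k => U (k + 1)) (fun k => hne _) (fun k => hU _)
    obtain ⟨x, hx, rfl⟩ := hU 0 (hy 0 (Nat.zero_le _))
    refine ⟨x, fun k hk => ?_⟩
    cases k with
    | zero => exact hx
    | succ k => exact hy k (by omega)

/-- A compact itinerary each of whose sets is covered by the image of the preceding one
is realized by an orbit. -/
theorem exists_forall_iterate_mem {α : Type*} [TopologicalSpace α] {f : α → α}
    (U : ℕ → Set α) (hne : ∀ k, (U k).Nonempty) (hU : ∀ k, U (k + 1) ⊆ f '' U k)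
    (hcl : ∀ k, IsClosed (U k)) (hcomp : IsCompact (U 0)) (hf : ∀ k, ContinuousOn f (U k)) :
    ∃ x, ∀ k, f^[k] x ∈ U k := by
  have hC : ∀ n, IsClosed {x | ∀ k ≤ n, f^[k] x ∈ U k} := fun n =>
    isClosed_setOf_forall_le_iterate_mem n U hcl hf
  obtain ⟨x, hx⟩ := IsCompact.nonempty_iInter_of_sequence_nonempty_isCompact_isClosed
    (fun n => {x | ∀ k ≤ n, f^[k] x ∈ U k}) (fun n x hx k hk => hx k (by omega))
    (fun n => exists_forall_le_iterate_mem n U hne hU)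
    (hcomp.of_isClosed_subset (hC 0) fun x hx => hx 0 le_rfl) hC
  exact ⟨x, fun k => mem_iInter.1 hx k k le_rfl⟩

/-- A positive nondecreasing sequence which doubles infinitely often is unbounded. -/
theorem exists_lt_of_frequently_two_mul_le {a : ℕ → ℝ} (h0 : 0 < a 0) (hmono : Monotone a)
    (hdouble : ∀ N, ∃ n, N ≤ n ∧ 2 * a n ≤ a (n + 1)) (B : ℝ) : ∃ n, B < a n := by
  have key : ∀ m : ℕ, ∃ n, 2 ^ m * a 0 ≤ a n := by
    intro m
    induction m with
    | zero => exact ⟨0, by simp⟩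
    | succ m ih =>
      obtain ⟨n, hn⟩ := ih
      obtain ⟨k, hk, h2⟩ := hdouble n
      refine ⟨k + 1, ?_⟩
      have := hmono hk
      rw [pow_succ]
      linarith
  obtain ⟨m, hm⟩ := pow_unbounded_of_one_lt (B / a 0) (one_lt_two : (1 : ℝ) < 2)
  obtain ⟨n, hn⟩ := key m
  exact ⟨n, ((div_lt_iff₀ h0).1 hm).trans_le hn⟩

/-- In an irreducible relation, if an infinite path beyond some time only passes through states
without another successor, then it visits every state beyond that time. -/
theorem exists_eq_of_unique_successor {I : Type*} {A : I → I → Prop}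
    (hirr : ∀ i j, ∃ n : ℕ, 0 < n ∧
      ∃ s : ℕ → I, s 0 = i ∧ s n = j ∧ ∀ k < n, A (s k) (s (k + 1)))
    {s : ℕ → I} {N : ℕ}
    (huniq : ∀ n, N ≤ n → ∀ j, A (s n) j → j = s (n + 1)) (i : I) : ∃ n, N ≤ n ∧ s n = i := by
  obtain ⟨n, -, t, ht0, htn, ht⟩ := hirr (s N) i
  have key : ∀ k ≤ n, t k = s (N + k) := by
    intro k
    induction k with
    | zero => intro _; simpa using ht0
    | succ k ih =>
      intro hk
      have hA := ht k (by omega)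
      rw [ih (by omega)] at hA
      exact huniq (N + k) (by omega) _ hA
  exact ⟨N + n, by omega, by rw [← key n le_rfl, htn]⟩

/-- A transitive generalized `p`-adic weak repeller is topologically conjugate to the
subshift of finite type determined by its incidence matrix. -/
theorem stmt_17 (p : ℕ) [hp : Fact p.Prime] (I : Type*) [Fintype I] [Nonempty I]
    [TopologicalSpace I] [DiscreteTopology I]
    (c : I → ℚ_[p]) (τ : I → ℤ) (D : I → Set ℚ_[p])
    (hD : ∀ i, D i = closedBall (c i) ((p : ℝ) ^ (-τ i)))
    (hdisj : Pairwise fun i j => Disjoint (D i) (D j))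
    (X : Set ℚ_[p]) (hX : X = ⋃ i, D i)
    (f : ℚ_[p] → ℚ_[p]) (γ : I → ℤ)
    (hscale : ∀ i, ∀ x ∈ D i, ∀ y ∈ D i, ‖f x - f y‖ = (p : ℝ) ^ (γ i) * ‖x - y‖)
    (hXf : X ⊆ f '' X)
    (h1 : ∀ i, ∃ j, D j ⊆ f '' D i)
    (h2 : ∃ i j, D j ⊆ f '' D i ∧ f '' D i ≠ D j)
    (A : I → I → Prop) (hA : ∀ i j, A i j ↔ D j ⊆ f '' D i)
    (hirr : ∀ i j, ∃ n : ℕ, 0 < n ∧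
      ∃ s : ℕ → I, s 0 = i ∧ s n = j ∧ ∀ k < n, A (s k) (s (k + 1)))
    (K : Set ℚ_[p]) (hK : K = {x : ℚ_[p] | ∀ n : ℕ, f^[n] x ∈ X}) :
    Set.MapsTo f K K ∧
    ∃ h : K ≃ₜ {s : ℕ → I // ∀ n : ℕ, A (s n) (s (n + 1))},
      (∀ (x : K) (hx : f (x : ℚ_[p]) ∈ K),
        ((h ⟨f (x : ℚ_[p]), hx⟩).1 = fun n => (h x).1 (n + 1))) ∧
      (∀ (x : K) (n : ℕ) (i : I), (h x).1 n = i ↔ f^[n] (x : ℚ_[p]) ∈ D i) := by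
  have hp1 : (1 : ℝ) < p := by exact_mod_cast (Fact.out : p.Prime).one_lt
  have hp0 : (0 : ℝ) < p := by linarith
  have hr : ∀ n : ℤ, (0 : ℝ) < (p : ℝ) ^ n := fun n => zpow_pos hp0 n
  have hDne : ∀ i, (D i).Nonempty := fun i => by
    rw [hD]; exact ⟨c i, mem_closedBall_self (hr _).le⟩
  have hDcl : ∀ i, IsClosed (D i) := fun i => by rw [hD]; exact isClosed_closedBall
  have hDop : ∀ i, IsOpen (D i) := fun i => by
    rw [hD]; exact IsUltrametricDist.isOpen_closedBall _ (hr _).ne'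
  have hDcp : ∀ i, IsCompact (D i) := fun i => by rw [hD]; exact isCompact_closedBall _ _
  have hinj : ∀ i j x, x ∈ D i → x ∈ D j → i = j := fun i j x hi hj => by
    by_contra hne
    exact Set.disjoint_left.1 (hdisj hne) hi hj
  have hsubeq : ∀ i j, D i ⊆ D j → i = j := fun i j hij => by
    obtain ⟨x, hx⟩ := hDne i
    exact hinj i j x hx (hij hx)
  have himg : ∀ i, f '' D i = closedBall (f (c i)) ((p : ℝ) ^ (γ i - τ i)) := fun i => by
    have hs := hscale i
    rw [hD] at hs ⊢
    rw [Padic.image_closedBall_of_norm_sub_eq (hr _).le hs, ← zpow_add₀ hp0.ne', sub_eq_add_neg]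
  have hle : ∀ i j, A i j → -τ j ≤ γ i - τ i := fun i j hij => by
    rw [hA, himg, hD] at hij
    exact Padic.le_of_closedBall_subset_closedBall hij
  have heq : ∀ i j, A i j → -τ j = γ i - τ i → f '' D i = D j := fun i j hij he => by
    rw [hA, himg, hD] at hij
    rw [himg, hD, he, IsUltrametricDist.closedBall_eq_of_mem (hij (mem_closedBall_self (hr _).le))]
  have hmeet : ∀ i j x, x ∈ D i → f x ∈ D j → A i j := fun i j x hx hfx => by
    have hfi : f x ∈ f '' D i := mem_image_of_mem f hx
    have h := IsUltrametricDist.closedBall_subset_trichotomy (c j) (f (c i))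
      ((p : ℝ) ^ (-τ j)) ((p : ℝ) ^ (γ i - τ i))
    rw [← himg, ← hD] at h
    rw [hA]
    rcases h with h | h | h
    · exact h
    · obtain ⟨k, hk⟩ := h1 i
      rwa [← hsubeq k j (hk.trans h)]
    · exact absurd hfi (Set.disjoint_left.1 h hfx)
  have hfD : ∀ i, ContinuousOn f (D i) := fun i => by
    refine LipschitzOnWith.continuousOn (K := ⟨(p : ℝ) ^ γ i, (hr _).le⟩)
      (LipschitzOnWith.of_dist_le_mul fun x hx y hy => ?_)
    rw [dist_eq_norm, dist_eq_norm, hscale i x hx y hy]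
    rfl
  have hfAt : ∀ x ∈ X, ContinuousAt f x := fun x hx => by
    rw [hX] at hx
    obtain ⟨i, hi⟩ := mem_iUnion.1 hx
    exact (hfD i).continuousAt ((hDop i).mem_nhds hi)
  have hXcp : IsCompact X := by rw [hX]; exact isCompact_iUnion hDcp
  have hKmem : ∀ x, x ∈ K ↔ ∀ n, f^[n] x ∈ X := fun x => by rw [hK]; rfl
  have hKcp : IsCompact K := by
    have hcl : IsClosed (⋂ n, {x | ∀ k ≤ n, f^[k] x ∈ X}) := isClosed_iInter fun n =>
      isClosed_setOf_forall_le_iterate_mem n (fun _ => X) (fun _ => hXcp.isClosed)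
        (fun _ x hx => (hfAt x hx).continuousWithinAt)
    have hKeq : K = ⋂ n, {x | ∀ k ≤ n, f^[k] x ∈ X} := by
      ext x
      rw [hKmem, mem_iInter]
      exact ⟨fun h n k _ => h k, fun h n => h n n le_rfl⟩
    rw [hKeq]
    exact hXcp.of_isClosed_subset hcl fun x hx => mem_iInter.1 hx 0 0 le_rfl
  have hmaps : MapsTo f K K := fun x hx => by
    rw [hKmem] at hx ⊢
    exact fun n => hx (n + 1)
  refine ⟨hmaps, ?_⟩
  have hcode : ∀ (x : K) (n : ℕ), ∃ i, f^[n] (x : ℚ_[p]) ∈ D i := fun x n => by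
    have hx := (hKmem _).1 x.2 n
    rw [hX] at hx
    exact mem_iUnion.1 hx
  choose s hs using hcode
  have hsA : ∀ x n, A (s x n) (s x (n + 1)) := fun x n => by
    refine hmeet _ _ _ (hs x n) ?_
    rw [← Function.iterate_succ_apply' f]
    exact hs x (n + 1)
  have hs_iff : ∀ (x : K) n i, s x n = i ↔ f^[n] (x : ℚ_[p]) ∈ D i := fun x n i =>
    ⟨fun h => h ▸ hs x n, fun h => hinj _ _ _ (hs x n) h⟩
  let H : K → {s : ℕ → I // ∀ n : ℕ, A (s n) (s (n + 1))} := fun x => ⟨s x, hsA x⟩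
  have hitAt : ∀ (n : ℕ) (x : K), ContinuousAt f^[n] (x : ℚ_[p]) := by
    intro n x
    induction n with
    | zero => exact continuousAt_id
    | succ n ih =>
      rw [Function.iterate_succ']
      exact (hfAt _ ((hKmem _).1 x.2 n)).comp ih
  have hHcont : Continuous H := by
    refine Continuous.subtype_mk (continuous_pi fun n => ?_) _
    refine continuous_iff_continuousAt.2 fun x => ?_
    have hev : ∀ᶠ y : K in nhds x, f^[n] (y : ℚ_[p]) ∈ D (s x n) :=
      ((hitAt n x).comp continuous_subtype_val.continuousAt).eventually_mem
        ((hDop _).mem_nhds (hs x n))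
    refine (continuousAt_const (y := s x n)).congr ?_
    filter_upwards [hev] with y hy
    exact ((hs_iff y n _).2 hy).symm
  have hHsurj : Function.Surjective H := by
    rintro ⟨t, ht⟩
    obtain ⟨x, hx⟩ := exists_forall_iterate_mem (f := f) (fun k => D (t k)) (fun k => hDne _)
      (fun k => (hA _ _).1 (ht k)) (fun k => hDcl _) (hDcp _) (fun k => hfD _)
    have hxK : x ∈ K := by
      rw [hKmem, hX]
      exact fun n => mem_iUnion.2 ⟨_, hx n⟩
    exact ⟨⟨x, hxK⟩, Subtype.ext (funext fun n => (hs_iff _ n _).2 (hx n))⟩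
  have hHinj : Function.Injective H := by
    intro x y hxy
    have hst : s x = s y := congrArg Subtype.val hxy
    by_contra hne
    have hsy : ∀ n, f^[n] (y : ℚ_[p]) ∈ D (s x n) := fun n => by rw [hst]; exact hs y n
    let a : ℕ → ℝ := fun n => (p : ℝ) ^ τ (s x n) * ‖f^[n] (x : ℚ_[p]) - f^[n] (y : ℚ_[p])‖
    have ha0 : 0 < a 0 :=
      mul_pos (hr _) (norm_pos_iff.2 (sub_ne_zero.2 fun h => hne (Subtype.ext h)))
    have hann : ∀ n, 0 ≤ a n := fun n => mul_nonneg (hr _).le (norm_nonneg _)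
    have ha1 : ∀ n, a n ≤ 1 := fun n => by
      have hx' := hs x n
      have hy' := hsy n
      rw [hD] at hx' hy'
      rw [IsUltrametricDist.closedBall_eq_of_mem hy', mem_closedBall, dist_eq_norm] at hx'
      calc a n ≤ (p : ℝ) ^ τ (s x n) * (p : ℝ) ^ (-τ (s x n)) := by
            exact mul_le_mul_of_nonneg_left hx' (hr _).le
        _ = 1 := by rw [← zpow_add₀ hp0.ne']; simp
    have hstep : ∀ n, a (n + 1) =
        (p : ℝ) ^ (γ (s x n) - τ (s x n) + τ (s x (n + 1))) * a n := fun n => by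
      simp only [a]
      rw [Function.iterate_succ_apply', Function.iterate_succ_apply',
        hscale _ _ (hs x n) _ (hsy n), ← mul_assoc, ← mul_assoc, ← zpow_add₀ hp0.ne',
        ← zpow_add₀ hp0.ne']
      congr 2
      ring
    have hmono : Monotone a := monotone_nat_of_le_succ fun n => by
      rw [hstep]
      have := hle _ _ (hsA x n)
      exact le_mul_of_one_le_left (hann n) (one_le_zpow₀ hp1.le (by omega))
    have hdouble : ∀ N, ∃ n, N ≤ n ∧ 2 * a n ≤ a (n + 1) := by
      by_contra! hcon
      obtain ⟨N, hN⟩ := hcon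
      have himeq : ∀ n, N ≤ n → f '' D (s x n) = D (s x (n + 1)) := fun n hn => by
        have hlen := hle _ _ (hsA x n)
        refine heq _ _ (hsA x n) (hlen.antisymm ?_)
        by_contra! hlt
        refine absurd (hN n hn) (not_lt.2 ?_)
        rw [hstep]
        refine mul_le_mul_of_nonneg_right ?_ (hann n)
        calc (2 : ℝ) ≤ (p : ℝ) ^ (1 : ℤ) := by
              rw [zpow_one]; exact_mod_cast (Fact.out : p.Prime).two_le
          _ ≤ _ := zpow_le_zpow_right₀ hp1.le (by omega)
      have huniq : ∀ n, N ≤ n → ∀ j, A (s x n) j → j = s x (n + 1) := fun n hn j hj => by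
        rw [hA, himeq n hn] at hj
        exact hsubeq _ _ hj
      obtain ⟨i, j, hij, hijne⟩ := h2
      obtain ⟨n, hn, rfl⟩ := exists_eq_of_unique_successor hirr huniq i
      have hj := huniq n hn j ((hA _ _).2 hij)
      exact hijne (hj ▸ himeq n hn)
    obtain ⟨n, hn⟩ := exists_lt_of_frequently_two_mul_le ha0 hmono hdouble 1
    exact absurd (ha1 n) (not_le.2 hn)
  have : CompactSpace K := isCompact_iff_compactSpace.1 hKcp
  refine ⟨Continuous.homeoOfEquivCompactToT2
    (f := Equiv.ofBijective H ⟨hHinj, hHsurj⟩) hHcont, ?_, hs_iff⟩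
  intro x hx
  funext n
  exact (hs_iff ⟨f x, hx⟩ n _).2 (hs x (n + 1))
end

section
/- Let a ∈ ℚ₂ with a ≠ 0, ‖a‖ = 1/4, and suppose there exists c ∈ ℚ₂ with a = 3·c². Then for every integer k ≥ 1: (1) every x ∈ ℚ₂ with ‖x‖ = 2^(2k+1) satisfies ‖φ^[k-1](x)‖ = 8; (2) every x ∈ ℚ₂ with ‖x‖ = 2^(-(2k+1)) satisfies ‖φ^[k](x)‖ = 8. -/
theorem norm_phi_eq_norm_mul {a x : ℚ_[2]} (h : ‖x⁻¹‖ < ‖a * x‖) : ‖phi a x‖ = ‖a * x‖ := by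
  rw [phi, Padic.add_eq_max_of_ne h.ne', max_eq_left h.le]

theorem norm_phi_eq_norm_inv {a x : ℚ_[2]} (h : ‖a * x‖ < ‖x⁻¹‖) : ‖phi a x‖ = ‖x⁻¹‖ := by
  rw [phi, Padic.add_eq_max_of_ne h.ne, max_eq_right h.le]

theorem norm_mul_eq_two_zpow {a x : ℚ_[2]} (ha : ‖a‖ = 1 / 4) {m : ℤ}
    (hx : ‖x‖ = (2 : ℝ) ^ m) : ‖a * x‖ = (2 : ℝ) ^ (m - 2) := by
  rw [norm_mul, ha, hx, zpow_sub₀ two_ne_zero]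
  norm_num
  ring

theorem norm_phi_of_one_lt {a x : ℚ_[2]} (ha : ‖a‖ = 1 / 4) {m : ℤ} (hm : 1 < m)
    (hx : ‖x‖ = (2 : ℝ) ^ m) : ‖phi a x‖ = (2 : ℝ) ^ (m - 2) := by
  have h := norm_mul_eq_two_zpow ha hx
  rw [norm_phi_eq_norm_mul, h]
  rw [h, norm_inv, hx, ← zpow_neg]
  exact zpow_lt_zpow_right₀ one_lt_two (by lia)

theorem norm_phi_of_lt_one {a x : ℚ_[2]} (ha : ‖a‖ = 1 / 4) {m : ℤ} (hm : m < 1)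
    (hx : ‖x‖ = (2 : ℝ) ^ m) : ‖phi a x‖ = (2 : ℝ) ^ (-m) := by
  rw [norm_phi_eq_norm_inv, norm_inv, hx, zpow_neg]
  rw [norm_mul_eq_two_zpow ha hx, norm_inv, hx, ← zpow_neg]
  exact zpow_lt_zpow_right₀ one_lt_two (by lia)

theorem norm_iterate_phi_eq_eight {a : ℚ_[2]} (ha : ‖a‖ = 1 / 4) (n : ℕ) {x : ℚ_[2]}
    (hx : ‖x‖ = (2 : ℝ) ^ (2 * (n : ℤ) + 3)) : ‖(phi a)^[n] x‖ = 8 := by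
  induction n generalizing x with
  | zero =>
    rw [Function.iterate_zero_apply, hx]
    norm_num
  | succ n ih =>
    rw [Function.iterate_succ_apply]
    apply ih
    rw [norm_phi_of_one_lt ha (by lia) hx]
    congr 1
    lia

theorem stmt_18 (a : ℚ_[2]) (ha0 : a ≠ 0) (ha : ‖a‖ = 1 / 4)
    (hsq3 : ∃ c : ℚ_[2], a = 3 * c ^ 2) (k : ℕ) (hk : 1 ≤ k) :
    (∀ x : ℚ_[2], ‖x‖ = (2 : ℝ) ^ (2 * (k : ℤ) + 1) → ‖(phi a)^[k - 1] x‖ = 8) ∧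
    (∀ x : ℚ_[2], ‖x‖ = (2 : ℝ) ^ (-(2 * (k : ℤ) + 1)) → ‖(phi a)^[k] x‖ = 8) := by
  obtain ⟨n, rfl⟩ := Nat.exists_eq_add_of_le' hk
  have hn : 2 * ((n + 1 : ℕ) : ℤ) + 1 = 2 * (n : ℤ) + 3 := by
    push_cast
    ring
  rw [hn, Nat.add_sub_cancel]
  refine ⟨fun x hx => norm_iterate_phi_eq_eight ha n hx, fun x hx => ?_⟩
  rw [Function.iterate_succ_apply]
  apply norm_iterate_phi_eq_eight ha
  rw [norm_phi_of_lt_one ha (by lia) hx, neg_neg]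
end

section
/- Let a ∈ ℚ₂ with a ≠ 0 and ‖a‖ < 1. Assume there is no b ∈ ℚ₂ with b² = -a, and assume it is not the case that both ‖a‖ = 1/4 and there exists c ∈ ℚ₂ with a = 3·c². Then for every x ∈ ℚ₂ with x ≠ 0 there exists N ∈ ℕ such that for all n ≥ N, √‖a‖ < ‖φ^[n](x)‖ < 1/√‖a‖ (i.e. every nonzero point is eventually absorbed into the φ-invariant annulus X_a = {x : √‖a‖ < ‖x‖ < 1/√‖a‖}). -/
namespace PhiDynamics

theorem norm_two : ‖(2 : ℚ_[2])‖ = 1 / 2 := by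
  simpa using Padic.norm_p (p := 2)

theorem norm_add_one_lt_one {t : ℚ_[2]} (ht : ‖t‖ = 1) : ‖t + 1‖ < 1 := by
  obtain ⟨n, hn, hm⟩ := PadicInt.exists_mem_range (p := 2) ⟨t, ht.le⟩
  rw [IsLocalRing.mem_maximalIdeal, PadicInt.mem_nonunits] at hm
  have h2 : ‖(2 : ℚ_[2])‖ < 1 := by rw [norm_two]; norm_num
  interval_cases n
  · have h : ‖t - ((0 : ℕ) : ℚ_[2])‖ < 1 := hm
    rw [Nat.cast_zero, sub_zero, ht] at h
    exact absurd h (lt_irrefl 1)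
  · have h : ‖t - ((1 : ℕ) : ℚ_[2])‖ < 1 := hm
    rw [Nat.cast_one] at h
    rw [show t + 1 = (t - 1) + 2 by ring]
    exact (Padic.nonarchimedean _ _).trans_lt (max_lt h h2)

theorem exists_sq_eq_of_norm_sub_one_lt {s : ℚ_[2]} (hs : ‖s - 1‖ < 1 / 4) :
    ∃ b : ℚ_[2], b ^ 2 = s := by
  have hs1 : ‖s‖ ≤ 1 := by
    have := Padic.nonarchimedean (s - 1) 1
    rw [sub_add_cancel, norm_one] at this
    exact this.trans (max_le (by linarith) le_rfl)
  let S : ℤ_[2] := ⟨s, hs1⟩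
  have key : ‖(Polynomial.X ^ 2 - Polynomial.C S : Polynomial ℤ_[2]).aeval (1 : ℤ_[2])‖ <
      ‖(Polynomial.X ^ 2 - Polynomial.C S : Polynomial ℤ_[2]).derivative.aeval (1 : ℤ_[2])‖ ^ 2 := by
    have h2' : ‖(2 : ℤ_[2])‖ = 1 / 2 := norm_two
    have : ‖(1 : ℤ_[2]) - S‖ < 1 / 4 := by
      rw [norm_sub_rev]; exact hs
    have hd : (Polynomial.X ^ 2 - Polynomial.C S : Polynomial ℤ_[2]).derivative.aeval
        (1 : ℤ_[2]) = 2 := by simp [one_add_one_eq_two]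
    rw [hd, h2']
    norm_num
    exact this
  obtain ⟨z, hz, -⟩ := hensels_lemma key
  refine ⟨z, ?_⟩
  have hz' : z ^ 2 = S := by simpa [sub_eq_zero] using hz
  exact congrArg (Subtype.val) hz'

theorem norm_le_half_of_lt_one {y : ℚ_[2]} (hy : ‖y‖ < 1) : ‖y‖ ≤ 1 / 2 := by
  have h := (Padic.norm_le_pow_iff_norm_lt_pow_add_one y (-1)).2 (by simpa using hy)
  norm_num at h
  linarith

theorem norm_four : ‖(4 : ℚ_[2])‖ = 1 / 4 := by
  rw [show (4 : ℚ_[2]) = 2 * 2 by norm_num, norm_mul, norm_two]; norm_num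

theorem norm_three : ‖(3 : ℚ_[2])‖ = 1 := by
  exact_mod_cast Padic.norm_natCast_eq_one_iff (p := 2) (n := 3) |>.2 (by decide)

/-- If `-t` is not a square, then the unit `t` has `‖t + 1‖ = 1 / 2`, or else `‖t + 1‖ = 1 / 4` and
`t` is three times a square. -/
theorem norm_add_one_of_unit {t : ℚ_[2]} (ht : ‖t‖ = 1) (hsq : ¬ ∃ b : ℚ_[2], b ^ 2 = -t) :
    ‖t + 1‖ = 1 / 2 ∨ (‖t + 1‖ = 1 / 4 ∧ ∃ c : ℚ_[2], t = 3 * c ^ 2) := by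
  have hlt := norm_add_one_lt_one ht
  have hle := norm_le_half_of_lt_one hlt
  have hge : 1 / 4 ≤ ‖t + 1‖ := by
    by_contra! h
    refine hsq (exists_sq_eq_of_norm_sub_one_lt ?_)
    rwa [show -t - 1 = -(t + 1) by ring, norm_neg]
  rcases hle.eq_or_lt with h | h
  · exact .inl h
  right
  have hw : ‖(t + 1) / 2‖ ≤ 1 / 2 := by
    apply norm_le_half_of_lt_one
    rw [norm_div, norm_two]; linarith
  have h4 : ‖t + 1‖ = 1 / 4 := by
    rw [norm_div, norm_two] at hw; linarith
  refine ⟨h4, ?_⟩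
  have hu : ‖(t + 1) / 4‖ = 1 := by
    rw [norm_div, norm_four, h4]; norm_num
  have hv : ‖-((t + 1) / 4) + 1‖ ≤ 1 / 2 :=
    norm_le_half_of_lt_one (norm_add_one_lt_one (by rwa [norm_neg]))
  obtain ⟨c, hc⟩ := exists_sq_eq_of_norm_sub_one_lt (s := t / 3) (by
    rw [show t / 3 - 1 = -(4 * (-((t + 1) / 4) + 1)) / 3 by ring, norm_div, norm_neg, norm_mul,
      norm_four, norm_three]
    linarith)
  exact ⟨c, by rw [hc]; ring⟩

variable {a x : ℚ_[2]}

theorem norm_phi_of_large (hx : 1 < ‖a‖ * ‖x‖ ^ 2) : ‖phi a x‖ = ‖a‖ * ‖x‖ := by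
  have hx0 : 0 < ‖x‖ := by
    rcases (norm_nonneg x).eq_or_lt with h | h
    · rw [← h] at hx; norm_num at hx
    · exact h
  have hlt : ‖x⁻¹‖ < ‖a * x‖ := by
    rw [norm_inv, norm_mul, inv_lt_iff_one_lt_mul₀ hx0]
    linarith
  rw [phi, Padic.add_eq_max_of_ne hlt.ne', max_eq_left hlt.le, norm_mul]

theorem norm_phi_of_small (hx0 : x ≠ 0) (hx : ‖a‖ * ‖x‖ ^ 2 < 1) : ‖phi a x‖ = ‖x‖⁻¹ := by
  have hx0 : 0 < ‖x‖ := norm_pos_iff.2 hx0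
  have hlt : ‖a * x‖ < ‖x⁻¹‖ := by
    rw [norm_inv, norm_mul, ← one_div, lt_div_iff₀ hx0]
    linarith
  rw [phi, Padic.add_eq_max_of_ne hlt.ne, max_eq_right hlt.le, norm_inv]

/-- The annulus `√‖a‖ < ‖x‖ < 1 / √‖a‖`, described without square roots. -/
def InAnnulus (a x : ℚ_[2]) : Prop := ‖a‖ < ‖x‖ ^ 2 ∧ ‖a‖ * ‖x‖ ^ 2 < 1

theorem InAnnulus.map (h : InAnnulus a x) : InAnnulus a (phi a x) := by
  obtain ⟨h1, h2⟩ := h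
  have hx0 : x ≠ 0 := by
    rintro rfl
    have := norm_nonneg a
    norm_num at h1
    linarith
  have hpos : 0 < ‖x‖ ^ 2 := pow_pos (norm_pos_iff.2 hx0) 2
  rw [InAnnulus, norm_phi_of_small hx0 h2, inv_pow]
  refine ⟨?_, ?_⟩
  · rwa [← one_div, lt_div_iff₀ hpos]
  · rwa [← div_eq_mul_inv, div_lt_one hpos]

theorem InAnnulus.iterate (h : InAnnulus a x) (n : ℕ) : InAnnulus a ((phi a)^[n] x) := by
  induction n with
  | zero => exact h
  | succ n ih => rw [Function.iterate_succ_apply']; exact ih.map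

theorem InAnnulus.sqrt_bounds (ha0 : a ≠ 0) (h : InAnnulus a x) :
    Real.sqrt ‖a‖ < ‖x‖ ∧ ‖x‖ < 1 / Real.sqrt ‖a‖ := by
  have hr : 0 < ‖a‖ := norm_pos_iff.2 ha0
  obtain ⟨h1, h2⟩ := h
  refine ⟨(Real.sqrt_lt' ?_).2 h1, ?_⟩
  · exact (norm_nonneg x).lt_of_ne (fun h0 => by rw [← h0] at h1; norm_num at h1; linarith)
  · rw [lt_div_iff₀ (Real.sqrt_pos.2 hr)]
    apply lt_of_pow_lt_pow_left₀ 2 zero_le_one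
    rw [mul_pow, Real.sq_sqrt hr.le]
    linarith

theorem exists_iterate_of_large (ha : ‖a‖ < 1) (ha0 : a ≠ 0) (hx : 1 < ‖a‖ * ‖x‖ ^ 2) :
    ∃ N : ℕ, ‖a‖ < ‖(phi a)^[N] x‖ ^ 2 ∧ ‖a‖ * ‖(phi a)^[N] x‖ ^ 2 ≤ 1 := by
  have hr : 0 < ‖a‖ := norm_pos_iff.2 ha0
  obtain ⟨n, hn⟩ : ∃ n : ℕ, ‖a‖ ^ n * ‖x‖ < 1 := by
    obtain ⟨n, hn⟩ := exists_pow_lt_of_lt_one (show 0 < 1 / (‖x‖ + 1) by positivity) ha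
    refine ⟨n, ?_⟩
    rw [lt_div_iff₀ (by positivity)] at hn
    have := pow_pos hr n
    linarith
  induction n generalizing x with
  | zero =>
    rw [pow_zero, one_mul] at hn
    have := norm_nonneg x
    nlinarith
  | succ n ih =>
    have hφ := norm_phi_of_large hx
    by_cases hl : 1 < ‖a‖ * ‖phi a x‖ ^ 2
    · obtain ⟨N, hN⟩ := ih hl (by rw [hφ]; rw [pow_succ] at hn; linarith)
      exact ⟨N + 1, by rwa [Function.iterate_succ_apply]⟩
    · refine ⟨1, ?_, not_lt.1 hl⟩
      rw [Function.iterate_one, hφ]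
      nlinarith

theorem exists_inAnnulus_of_boundary (ha0 : a ≠ 0) (ha : ‖a‖ < 1)
    (hsq : ¬ ∃ b : ℚ_[2], b ^ 2 = -a)
    (hcase : ¬ (‖a‖ = 1 / 4 ∧ ∃ c : ℚ_[2], a = 3 * c ^ 2))
    (hx : ‖a‖ * ‖x‖ ^ 2 = 1) : ∃ N : ℕ, InAnnulus a ((phi a)^[N] x) := by
  have hr : 0 < ‖a‖ := norm_pos_iff.2 ha0
  have hx0 : x ≠ 0 := by rintro rfl; norm_num at hx
  have hpos : 0 < ‖x‖ := norm_pos_iff.2 hx0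
  set t := a * x ^ 2 with ht
  have hta : a = t / x ^ 2 := by rw [ht]; field_simp
  have hnt : ‖t‖ = 1 := by rw [ht, norm_mul, norm_pow, hx]
  have hinv : ‖x⁻¹‖ ≤ 1 / 2 := by
    apply norm_le_half_of_lt_one
    rw [norm_inv]
    apply inv_lt_one_of_one_lt₀
    by_contra! h
    have : ‖x‖ ^ 2 ≤ 1 := pow_le_one₀ hpos.le h
    nlinarith
  have har : ‖a‖ = ‖x⁻¹‖ ^ 2 := by rw [norm_inv]; field_simp; linarith
  have hquarter : ‖a‖ ≤ 1 / 4 := by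
    rw [har]; nlinarith [norm_nonneg x⁻¹]
  obtain ⟨hd0, hd1, hd⟩ : 0 < ‖t + 1‖ ∧ ‖t + 1‖ < 1 ∧ ‖a‖ < ‖t + 1‖ := by
    rcases norm_add_one_of_unit hnt (fun ⟨b, hb⟩ => hsq ⟨b / x, by
      rw [div_pow, hb, neg_div, ← hta]⟩) with h | ⟨h, c, hc⟩
    · rw [h]; refine ⟨by norm_num, by norm_num, by linarith⟩
    · rw [h]
      refine ⟨by norm_num, by norm_num, hquarter.lt_of_ne fun h4 => hcase ⟨h4, c / x, ?_⟩⟩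
      rw [hta, hc]; ring
  set d := ‖t + 1‖
  have h1 : ‖phi a x‖ = d / ‖x‖ := by
    rw [← norm_div, phi, ht]; congr 1; field_simp
  have hy0 : phi a x ≠ 0 := by rw [← norm_pos_iff, h1]; positivity
  have h2 : ‖phi a (phi a x)‖ = ‖x‖ / d := by
    rw [norm_phi_of_small hy0, h1, inv_div]
    rw [h1, div_pow]
    have : ‖a‖ * (d ^ 2 / ‖x‖ ^ 2) = (‖a‖ * d) ^ 2 := by
      field_simp; linear_combination -hx
    rw [this]
    have : ‖a‖ * d < 1 := by nlinarith
    have : 0 < ‖a‖ * d := by positivity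
    nlinarith
  have h3 : ‖phi a (phi a (phi a x))‖ = ‖a‖ * (‖x‖ / d) := by
    rw [norm_phi_of_large, h2]
    rw [h2, div_pow, ← mul_div_assoc, hx, one_lt_div (by positivity)]
    nlinarith
  refine ⟨3, ?_⟩
  change InAnnulus a (phi a (phi a (phi a x)))
  have h4 : (‖a‖ * (‖x‖ / d)) ^ 2 = ‖a‖ / d ^ 2 := by
    field_simp; linear_combination hx
  rw [InAnnulus, h3, h4]
  constructor
  · rw [lt_div_iff₀ (by positivity)]
    have : d ^ 2 < 1 := by nlinarith
    nlinarith
  · rw [← mul_div_assoc, div_lt_one (by positivity)]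
    nlinarith

theorem exists_inAnnulus (ha0 : a ≠ 0) (ha : ‖a‖ < 1)
    (hsq : ¬ ∃ b : ℚ_[2], b ^ 2 = -a)
    (hcase : ¬ (‖a‖ = 1 / 4 ∧ ∃ c : ℚ_[2], a = 3 * c ^ 2))
    (hx : x ≠ 0) : ∃ N : ℕ, InAnnulus a ((phi a)^[N] x) := by
  have shift : ∀ {y : ℚ_[2]} (M : ℕ), (∃ N : ℕ, InAnnulus a ((phi a)^[N] ((phi a)^[M] y))) →
      ∃ N : ℕ, InAnnulus a ((phi a)^[N] y) := by
    rintro y M ⟨N, hN⟩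
    exact ⟨N + M, by rwa [Function.iterate_add_apply]⟩
  have boundary : ∀ {y : ℚ_[2]}, ‖a‖ * ‖y‖ ^ 2 = 1 → ∃ N : ℕ, InAnnulus a ((phi a)^[N] y) :=
    fun hy => exists_inAnnulus_of_boundary ha0 ha hsq hcase hy
  have large : ∀ {y : ℚ_[2]}, 1 < ‖a‖ * ‖y‖ ^ 2 → ∃ N : ℕ, InAnnulus a ((phi a)^[N] y) := by
    intro y hy
    obtain ⟨M, hM1, hM2⟩ := exists_iterate_of_large ha ha0 hy
    rcases hM2.eq_or_lt with h | h
    · exact shift M (boundary h)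
    · exact ⟨M, hM1, h⟩
  rcases lt_trichotomy (‖a‖ * ‖x‖ ^ 2) 1 with h | h | h
  · have hpos : 0 < ‖x‖ ^ 2 := pow_pos (norm_pos_iff.2 hx) 2
    have hφ : ‖a‖ * ‖phi a x‖ ^ 2 = ‖a‖ / ‖x‖ ^ 2 := by
      rw [norm_phi_of_small hx h, inv_pow, div_eq_mul_inv]
    rcases lt_trichotomy ‖a‖ (‖x‖ ^ 2) with h' | h' | h'
    · exact ⟨0, h', h⟩
    · refine shift 1 (boundary ?_)
      rw [Function.iterate_one, hφ, h', div_self hpos.ne']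
    · refine shift 1 (large ?_)
      rwa [Function.iterate_one, hφ, one_lt_div hpos]
  · exact boundary h
  · exact large h

end PhiDynamics

theorem stmt_19 (a : ℚ_[2]) (ha0 : a ≠ 0) (ha : ‖a‖ < 1)
    (hsq : ¬ ∃ b : ℚ_[2], b ^ 2 = -a)
    (hcase : ¬ (‖a‖ = 1 / 4 ∧ ∃ c : ℚ_[2], a = 3 * c ^ 2))
    (x : ℚ_[2]) (hx : x ≠ 0) :
    ∃ N : ℕ, ∀ n ≥ N,
      Real.sqrt ‖a‖ < ‖(phi a)^[n] x‖ ∧ ‖(phi a)^[n] x‖ < 1 / Real.sqrt ‖a‖ := by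
  obtain ⟨N, hN⟩ := PhiDynamics.exists_inAnnulus ha0 ha hsq hcase hx
  refine ⟨N, fun n hn => ?_⟩
  have h := hN.iterate (n - N)
  rw [← Function.iterate_add_apply, Nat.sub_add_cancel hn] at h
  exact h.sqrt_bounds ha0
end
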